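/- Let χ_d be a quadratic (real primitive) Dirichlet character of conductor d and let η be −1 or 1. Then, as x → ∞ with d fixed, (#{(p,q) : p, q prime, pq ≤ x, χ_d(p) = χ_d(q) = η}) / ((1/4)·#{(p,q) : p, q prime, pq ≤ x, gcd(pq, d) = 1}) = 1 + η·(𝓛_{χ_d} + o(1)) / log log x. -/

import Mathlib

open Filter

/-- The Dirichlet L-function of `χ` (extended by `0` for modulus `0`). -/
noncomputable def LFun (d : ℕ) (χ : DirichletCharacter ℂ d) (s : ℂ) : ℂ :=
  if h : d ≠ 0 then
    letI : NeZero d := ⟨h⟩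
    DirichletCharacter.LFunction χ s
  else 0

/-- `𝓛_χ = Σ_p χ(p)/p` has value `L`: the partial sums over primes `p < y`
converge to `L` as `y → ∞`. -/
def HasCurlyL {d : ℕ} (χ : DirichletCharacter ℂ d) (L : ℝ) : Prop :=
  Filter.Tendsto
    (fun y : ℕ => ∑ p ∈ (Finset.range y).filter Nat.Prime, (χ p).re / (p : ℝ))
    Filter.atTop (nhds L)

/-- Number of ordered pairs `(p, q)` of primes with `p * q ≤ x` satisfying `P p q`. -/
noncomputable def pairCount (x : ℝ) (P : ℕ → ℕ → Prop) : ℕ :=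
  Nat.card {pq : ℕ × ℕ // pq.1.Prime ∧ pq.2.Prime ∧ ((pq.1 * pq.2 : ℕ) : ℝ) ≤ x ∧ P pq.1 pq.2}

/-- The race ratio `#{pq ≤ x : χ(p) = χ(q) = η} / ((1/4) #{pq ≤ x : gcd(pq, d) = 1})`,
where products of two primes are counted as ordered pairs. -/
noncomputable def raceRatio {d : ℕ} (χ : DirichletCharacter ℂ d) (η : ℂ) (x : ℝ) : ℝ :=
  (pairCount x (fun p q => χ p = η ∧ χ q = η) : ℝ) /
    ((1 / 4 : ℝ) * (pairCount x (fun p q => Nat.gcd (p * q) d = 1) : ℝ))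

/-- A positive integer is a fundamental discriminant if it is `≡ 1 (mod 4)` and squarefree,
or is `4m` with `m ≡ 2, 3 (mod 4)` squarefree. -/
def IsFundamentalDiscriminant (d : ℕ) : Prop :=
  0 < d ∧ ((d % 4 = 1 ∧ Squarefree d) ∨
    (d % 4 = 0 ∧ Squarefree (d / 4) ∧ (d / 4 % 4 = 2 ∨ d / 4 % 4 = 3)))

/-- The Generalized Riemann Hypothesis for Dirichlet L-functions: all zeros in the
critical strip lie on the critical line. -/
def GRH : Prop :=
  ∀ (d : ℕ), d ≠ 0 → ∀ (χ : DirichletCharacter ℂ d) (s : ℂ),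
    LFun d χ s = 0 → 0 < s.re → s.re < 1 → s.re = 1 / 2

/-- `L(s, χ)` has no real zero `β` with `1 - c / log d ≤ β ≤ 1` (a Siegel zero). -/
def HasNoSiegelZero (c : ℝ) (d : ℕ) (χ : DirichletCharacter ℂ d) : Prop :=
  ¬ ∃ β : ℝ, 1 - c / Real.log d ≤ β ∧ β ≤ 1 ∧ LFun d χ (β : ℂ) = 0

/-- The logarithmic integral `Li(t) = ∫_2^t du / log u`. -/
noncomputable def Li (t : ℝ) : ℝ := ∫ u in (2:ℝ)..t, 1 / Real.log u

namespace DGK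
open Complex MeasureTheory Set Topology

/-- Remainder function of the summatory function of `f`. -/
noncomputable def rem (f : ℕ → ℂ) (c : ℂ) (t : ℝ) : ℂ :=
  if 1 < t then (∑ k ∈ Finset.Icc 1 ⌊t⌋₊, f k) - c * t else 0

lemma measurable_rem (f : ℕ → ℂ) (c : ℂ) : Measurable (rem f c) := by
  unfold rem
  refine Measurable.ite measurableSet_Ioi ?_ measurable_const
  refine Measurable.sub ?_ (by fun_prop)
  exact (measurable_from_top (f := fun n : ℕ => ∑ k ∈ Finset.Icc 1 n, f k)).comp Nat.measurable_floor

lemma rem_bound {f : ℕ → ℂ} {c : ℂ} {C : ℝ}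
    (h : ∀ t : ℝ, 1 < t → ‖(∑ k ∈ Finset.Icc 1 ⌊t⌋₊, f k) - c * t‖ ≤ C) (t : ℝ) :
    ‖rem f c t‖ ≤ C := by
  unfold rem
  split_ifs with ht
  · exact h t ht
  · simpa using (norm_nonneg _).trans (h 2 (by norm_num))

lemma rem_locInt {f : ℕ → ℂ} {c : ℂ} {C : ℝ}
    (h : ∀ t : ℝ, 1 < t → ‖(∑ k ∈ Finset.Icc 1 ⌊t⌋₊, f k) - c * t‖ ≤ C) :
    LocallyIntegrableOn (rem f c) (Ioi 0) := by
  have : LocallyIntegrable (rem f c) := by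
    refine LocallyIntegrable.mono (locallyIntegrable_const (C : ℝ)) (measurable_rem f c).aestronglyMeasurable ?_
    filter_upwards with t
    exact (rem_bound h t).trans (le_abs_self _)
  exact this.locallyIntegrableOn _

/-- The function `s ↦ s ∫_1^∞ R(t) t^{-s-1} dt`. -/
noncomputable def Mfun (f : ℕ → ℂ) (c : ℂ) (s : ℂ) : ℂ := s * mellin (rem f c) (-s)

lemma rem_O1 {f : ℕ → ℂ} {c : ℂ} {C : ℝ}
    (h : ∀ t : ℝ, 1 < t → ‖(∑ k ∈ Finset.Icc 1 ⌊t⌋₊, f k) - c * t‖ ≤ C) :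
    rem f c =O[atTop] fun x : ℝ => x ^ (-(0:ℝ)) := by
  refine Asymptotics.IsBigO.of_bound C ?_
  filter_upwards with t
  simpa using rem_bound h t

lemma rem_O2 (f : ℕ → ℂ) (c : ℂ) (b : ℝ) :
    rem f c =O[𝓝[>] 0] fun x : ℝ => x ^ (-b) := by
  have : rem f c =ᶠ[𝓝[>] 0] fun _ => 0 := by
    filter_upwards [nhdsWithin_le_nhds (Iio_mem_nhds (zero_lt_one (α := ℝ)))] with t ht
    simp only [rem]
    rw [if_neg (not_lt.mpr (le_of_lt ht))]
  exact this.trans_isBigO (Asymptotics.isBigO_zero _ _)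

lemma Mfun_diff {f : ℕ → ℂ} {c : ℂ} {C : ℝ}
    (h : ∀ t : ℝ, 1 < t → ‖(∑ k ∈ Finset.Icc 1 ⌊t⌋₊, f k) - c * t‖ ≤ C) {s : ℂ} (hs : 0 < s.re) :
    DifferentiableAt ℂ (Mfun f c) s := by
  have h1 : DifferentiableAt ℂ (mellin (rem f c)) (-s) :=
    mellin_differentiableAt_of_isBigO_rpow (a := 0) (b := (-s).re - 1) (rem_locInt h) (rem_O1 h)
      (by simpa using hs) (rem_O2 f c _) (by simp)
  exact differentiableAt_id.mul (h1.comp s differentiable_neg.differentiableAt)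

lemma mellin_rem (f : ℕ → ℂ) (c : ℂ) (s : ℂ) :
    mellin (rem f c) (-s) =
      ∫ t in Ioi (1:ℝ), ((∑ k ∈ Finset.Icc 1 ⌊t⌋₊, f k) - c * t) * (t:ℂ) ^ (-(s + 1)) := by
  rw [mellin, ← integral_indicator measurableSet_Ioi, ← integral_indicator measurableSet_Ioi]
  congr 1
  ext t
  simp only [indicator, mem_Ioi, rem]
  by_cases h1 : 1 < t
  · rw [if_pos h1, if_pos h1, if_pos (zero_lt_one.trans h1)]
    rw [smul_eq_mul, mul_comm]; congr 2; ring
  · simp [h1]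

lemma Mfun_bound {f : ℕ → ℂ} {c : ℂ} {C : ℝ}
    (h : ∀ t : ℝ, 1 < t → ‖(∑ k ∈ Finset.Icc 1 ⌊t⌋₊, f k) - c * t‖ ≤ C) {s : ℂ} (hs : 0 < s.re) :
    ‖Mfun f c s‖ ≤ ‖s‖ * (C / s.re) := by
  rw [Mfun, norm_mul, mellin_rem]
  refine mul_le_mul_of_nonneg_left ?_ (norm_nonneg _)
  have hi : IntegrableOn (fun t : ℝ => C * t ^ (-s.re - 1)) (Ioi 1) :=
    ((integrableOn_Ioi_rpow_of_lt (by linarith) zero_lt_one)).const_mul C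
  refine (norm_integral_le_of_norm_le hi ?_).trans ?_
  · refine (ae_restrict_iff' measurableSet_Ioi).mpr (Eventually.of_forall fun t ht => ?_)
    rw [norm_mul, norm_cpow_eq_rpow_re_of_pos (zero_lt_one.trans ht)]
    have : (-(s+1)).re = -s.re - 1 := by simp; ring
    rw [this]
    exact mul_le_mul_of_nonneg_right (h t ht) (Real.rpow_nonneg (zero_lt_one.trans ht).le _)
  · rw [integral_const_mul, integral_Ioi_rpow_of_lt (by linarith) zero_lt_one]
    simp
    rw [div_eq_mul_inv]

lemma LSeries_eq_Mfun {f : ℕ → ℂ} {c : ℂ} {C : ℝ}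
    (h : ∀ t : ℝ, 1 < t → ‖(∑ k ∈ Finset.Icc 1 ⌊t⌋₊, f k) - c * t‖ ≤ C) {s : ℂ} (hs : 1 < s.re)
    (hS : LSeriesSummable f s) :
    LSeries f s = c * (s / (s - 1)) + Mfun f c s := by
  have hs0 : s - 1 ≠ 0 := by
    intro h0
    have : s = 1 := by linear_combination h0
    rw [this] at hs; simp at hs
  rw [LSeries_eq_mul_integral f zero_le_one hs hS, Mfun, mellin_rem]
  · have h1 : ∫ t in Ioi (1:ℝ), c * (t:ℂ) ^ (-s) = c / (s - 1) := by
      rw [integral_const_mul, integral_Ioi_cpow_of_lt (by simpa using hs) zero_lt_one]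
      simp
      rw [show (-s + 1) = -(s-1) by ring, neg_div_neg_eq]
      field_simp
    have i1 : IntegrableOn (fun t : ℝ => c * (t:ℂ) ^ (-s)) (Ioi 1) :=
      (integrableOn_Ioi_cpow_of_lt (by simpa using hs) zero_lt_one).const_mul c
    have i2 : IntegrableOn (fun t : ℝ =>
        ((∑ k ∈ Finset.Icc 1 ⌊t⌋₊, f k) - c * t) * (t:ℂ) ^ (-(s + 1))) (Ioi 1) := by
      have hi : IntegrableOn (fun t : ℝ => C * t ^ (-s.re - 1)) (Ioi 1) :=
        ((integrableOn_Ioi_rpow_of_lt (by linarith) zero_lt_one)).const_mul C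
      refine hi.mono' ?_ ?_
      · refine Measurable.aestronglyMeasurable ?_
        refine Measurable.mul (Measurable.sub ?_ (by fun_prop)) (by fun_prop)
        exact (measurable_from_top (f := fun n : ℕ => ∑ k ∈ Finset.Icc 1 n, f k)).comp
          Nat.measurable_floor
      · refine (ae_restrict_iff' measurableSet_Ioi).mpr (Eventually.of_forall fun t ht => ?_)
        rw [norm_mul, norm_cpow_eq_rpow_re_of_pos (zero_lt_one.trans ht)]
        have : (-(s+1)).re = -s.re - 1 := by simp; ring
        rw [this]
        exact mul_le_mul_of_nonneg_right (h t ht) (Real.rpow_nonneg (zero_lt_one.trans ht).le _)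
    have : ∫ t in Ioi (1:ℝ), (∑ k ∈ Finset.Icc 1 ⌊t⌋₊, f k) * (t:ℂ) ^ (-(s + 1)) =
        c / (s-1) + ∫ t in Ioi (1:ℝ), ((∑ k ∈ Finset.Icc 1 ⌊t⌋₊, f k) - c * t) * (t:ℂ) ^ (-(s + 1)) := by
      rw [← h1, ← integral_add i1 i2]
      refine setIntegral_congr_fun measurableSet_Ioi fun t ht => ?_
      have ht0 : (t:ℂ) ≠ 0 := by
        have : (0:ℝ) < t := zero_lt_one.trans ht
        exact_mod_cast this.ne'
      have : (t:ℂ) ^ (-s) = t * (t:ℂ) ^ (-(s+1)) := by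
        rw [show -s = 1 + (-(s+1)) by ring, cpow_add _ _ ht0, cpow_one]
      simp only [this]; ring
    rw [this]; ring
  · refine Asymptotics.IsBigO.of_bound (C + ‖c‖) ?_
    filter_upwards [eventually_gt_atTop 1] with n hn
    have h1 := h n (by exact_mod_cast hn)
    rw [Nat.floor_natCast] at h1
    have hn1 : (1:ℝ) ≤ n := by exact_mod_cast hn.le
    have hC : 0 ≤ C := (norm_nonneg _).trans h1
    have h2 : ‖c * ((n:ℝ):ℂ)‖ = ‖c‖ * n := by rw [norm_mul]; simp
    calc ‖∑ k ∈ Finset.Icc 1 n, f k‖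
        = ‖((∑ k ∈ Finset.Icc 1 n, f k) - c * ((n:ℝ):ℂ)) + c * ((n:ℝ):ℂ)‖ := by congr 1; ring
      _ ≤ C + ‖c‖ * n := (norm_add_le _ _).trans (by rw [h2]; linarith)
      _ ≤ (C + ‖c‖) * ‖(n:ℝ)^(1:ℝ)‖ := by
        rw [Real.rpow_one, Real.norm_of_nonneg (by linarith)]; nlinarith

lemma eqOn_half {F G : ℂ → ℂ} (hF : ∀ s : ℂ, 0 < s.re → DifferentiableAt ℂ F s)
    (hG : ∀ s : ℂ, 0 < s.re → DifferentiableAt ℂ G s) (h : ∀ s : ℂ, 1 < s.re → F s = G s)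
    {s : ℂ} (hs : 0 < s.re) : F s = G s := by
  have ho : IsOpen {s : ℂ | 0 < s.re} := isOpen_lt continuous_const continuous_re
  have a1 : AnalyticOnNhd ℂ F {s : ℂ | 0 < s.re} :=
    DifferentiableOn.analyticOnNhd (fun s hs => (hF s hs).differentiableWithinAt) ho
  have a2 : AnalyticOnNhd ℂ G {s : ℂ | 0 < s.re} :=
    DifferentiableOn.analyticOnNhd (fun s hs => (hG s hs).differentiableWithinAt) ho
  have hc : IsPreconnected {s : ℂ | 0 < s.re} := (convex_halfSpace_re_gt 0).isPreconnected
  refine a1.eqOn_of_preconnected_of_eventuallyEq a2 hc (z₀ := 2) (by simp) ?_ hs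
  have : {s : ℂ | 1 < s.re} ∈ 𝓝 (2:ℂ) :=
    (isOpen_lt continuous_const continuous_re).mem_nhds (by simp)
  filter_upwards [this] with s hs using h s hs

lemma zeta0_bound {s : ℂ} (hs : 0 < s.re) : ‖riemannZeta₀ s‖ ≤ 1 + ‖s‖ * (1 / s.re) := by
  have h : ∀ t : ℝ, 1 < t → ‖(∑ k ∈ Finset.Icc 1 ⌊t⌋₊, (1 : ℕ → ℂ) k) - 1 * t‖ ≤ 1 := by
    intro t ht
    simp only [Pi.one_apply, Finset.sum_const, Nat.card_Icc, add_tsub_cancel_right, nsmul_eq_mul,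
      mul_one, one_mul]
    rw [show ((⌊t⌋₊ : ℂ) - (t:ℂ)) = (((⌊t⌋₊ : ℝ) - t : ℝ) : ℂ) by push_cast; rfl, norm_real,
      Real.norm_eq_abs, abs_le]
    have h1 := Nat.floor_le (show 0 ≤ t by linarith)
    have h2 := Nat.lt_floor_add_one t
    constructor <;> linarith
  have key : riemannZeta₀ s = 1 + Mfun 1 1 s := by
    refine eqOn_half (F := riemannZeta₀) (G := fun s => 1 + Mfun 1 1 s) (fun s _ => by fun_prop)
      (fun s hs => (Mfun_diff h hs).const_add _) (fun s hs => ?_) hs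
    have h1 := LSeries_eq_Mfun h hs (LSeriesSummable_one_iff.mpr hs)
    have hs1 : s ≠ 1 := by rintro rfl; simp at hs
    have hs0 : s - 1 ≠ 0 := sub_ne_zero.mpr hs1
    rw [LSeries_one_eq_riemannZeta hs, riemannZeta_eq_inv_sub_add hs1] at h1
    have : s / (s-1) = 1 + (s-1)⁻¹ := by field_simp; ring
    rw [this] at h1
    linear_combination h1
  rw [key]
  exact (norm_add_le _ _).trans (by simpa using Mfun_bound h hs)

lemma char_sum_bound {d : ℕ} [NeZero d] {χ : DirichletCharacter ℂ d} (hχ : χ ≠ 1) (n : ℕ) :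
    ‖∑ k ∈ Finset.range n, χ k‖ ≤ d := by
  have hp : ∀ n : ℕ, ∑ k ∈ Finset.Ico n (n + d), χ k = 0 := by
    intro n
    have h0 : ∑ k ∈ Finset.range d, χ k = 0 := by
      rw [← MulChar.sum_eq_zero_of_ne_one hχ]
      refine Finset.sum_bij (fun k _ => (k : ZMod d)) (by simp) ?_ ?_ (by simp)
      · intro a ha b hb hab
        rw [ZMod.natCast_eq_natCast_iff'] at hab
        rw [Finset.mem_range] at ha hb
        rwa [Nat.mod_eq_of_lt ha, Nat.mod_eq_of_lt hb] at hab
      · intro b _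
        exact ⟨b.val, Finset.mem_range.mpr (ZMod.val_lt b), ZMod.natCast_zmod_val b⟩
    induction n with
    | zero => simpa using h0
    | succ n ih =>
      have h1 := Finset.sum_Ico_succ_top (show n ≤ n + d by omega) (fun k : ℕ => χ k)
      have h2 := Finset.sum_eq_sum_Ico_succ_bot (show n < n + d + 1 by omega) (fun k : ℕ => χ k)
      rw [h1, ih] at h2
      rw [show n + 1 + d = n + d + 1 by ring]
      have h3 : χ ((n + d : ℕ) : ZMod d) = χ (n : ZMod d) := by simp
      rw [h3] at h2
      linear_combination -h2
  induction n using Nat.strong_induction_on with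
  | _ n ih =>
    by_cases hn : n < d
    · refine (norm_sum_le _ _).trans ?_
      refine (Finset.sum_le_card_nsmul _ _ 1 (fun k _ => χ.norm_le_one _)).trans ?_
      simp; exact_mod_cast hn.le
    · push Not at hn
      have hd := NeZero.pos d
      have := ih (n - d) (by omega)
      rw [← Finset.sum_range_add_sum_Ico (fun k : ℕ => χ k) (show n - d ≤ n by omega)]
      have h2 := hp (n - d)
      rw [Nat.sub_add_cancel hn] at h2
      rwa [h2, add_zero]

lemma LFun_bound {d : ℕ} [NeZero d] {χ : DirichletCharacter ℂ d} (hχ : χ ≠ 1) {s : ℂ}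
    (hs : 0 < s.re) : ‖DirichletCharacter.LFunction χ s‖ ≤ ‖s‖ * ((d+1:ℝ) / s.re) := by
  have h : ∀ t : ℝ, 1 < t → ‖(∑ k ∈ Finset.Icc 1 ⌊t⌋₊, (fun n : ℕ => χ n) k) - 0 * t‖ ≤ (d+1:ℝ) := by
    intro t ht
    have : ∑ k ∈ Finset.Icc 1 ⌊t⌋₊, χ (k:ZMod d) = ∑ k ∈ Finset.range (⌊t⌋₊+1), χ k - χ (0:ℕ) := by
      rw [Finset.sum_range_eq_add_Ico _ (by omega)]
      simp only [Nat.cast_zero, add_sub_cancel_left]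
      rfl
    simp only [this, zero_mul, sub_zero]
    refine (norm_sub_le _ _).trans (add_le_add (char_sum_bound hχ _) (χ.norm_le_one _))
  have key : DirichletCharacter.LFunction χ s = Mfun (fun n => χ n) 0 s := by
    refine eqOn_half (F := DirichletCharacter.LFunction χ)
      (fun s _ => DirichletCharacter.differentiable_LFunction hχ s)
      (fun s hs => Mfun_diff h hs) (fun s hs => ?_) hs
    rw [DirichletCharacter.LFunction_eq_LSeries χ hs,
      LSeries_eq_Mfun h hs (DirichletCharacter.LSeriesSummable_of_one_lt_re χ hs)]
    simp
  rw [key]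
  exact Mfun_bound h hs

end DGK

namespace DGK
open Complex MeasureTheory Set Topology

/-- Polynomial growth in the imaginary direction on `S`. -/
def PG (S : Set ℂ) (F : ℂ → ℂ) : Prop :=
  ∃ C : ℝ, 0 ≤ C ∧ ∃ A : ℕ, ∀ s ∈ S, ‖F s‖ ≤ C * (2 + |s.im|) ^ A

/-- Closed vertical strip. -/
def strip (a b : ℝ) : Set ℂ := {s | a ≤ s.re ∧ s.re ≤ b}

lemma strip_mono {a b a' b' : ℝ} (h1 : a' ≤ a) (h2 : b ≤ b') : strip a b ⊆ strip a' b' :=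
  fun _ hs => ⟨h1.trans hs.1, hs.2.trans h2⟩

lemma PG.mono {S S' : Set ℂ} {F : ℂ → ℂ} (h : PG S F) (hs : S' ⊆ S) : PG S' F := by
  obtain ⟨C, hC, A, h⟩ := h
  exact ⟨C, hC, A, fun s hs' => h s (hs hs')⟩

lemma PG.add {S : Set ℂ} {F G : ℂ → ℂ} (hF : PG S F) (hG : PG S G) : PG S (fun s => F s + G s) := by
  obtain ⟨C, hC, A, hF⟩ := hF
  obtain ⟨D, hD, B, hG⟩ := hG
  refine ⟨C + D, by positivity, A + B, fun s hs => ?_⟩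
  have hT : (1:ℝ) ≤ 2 + |s.im| := by linarith [abs_nonneg s.im]
  have h1 : (2 + |s.im|) ^ A ≤ (2 + |s.im|) ^ (A + B) := pow_le_pow_right₀ hT (by omega)
  have h2 : (2 + |s.im|) ^ B ≤ (2 + |s.im|) ^ (A + B) := pow_le_pow_right₀ hT (by omega)
  calc ‖F s + G s‖ ≤ ‖F s‖ + ‖G s‖ := norm_add_le _ _
    _ ≤ C * (2 + |s.im|) ^ A + D * (2 + |s.im|) ^ B := add_le_add (hF s hs) (hG s hs)
    _ ≤ C * (2 + |s.im|) ^ (A + B) + D * (2 + |s.im|) ^ (A + B) := by gcongr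
    _ = _ := by ring

lemma PG.mul {S : Set ℂ} {F G : ℂ → ℂ} (hF : PG S F) (hG : PG S G) : PG S (fun s => F s * G s) := by
  obtain ⟨C, hC, A, hF⟩ := hF
  obtain ⟨D, hD, B, hG⟩ := hG
  refine ⟨C * D, by positivity, A + B, fun s hs => ?_⟩
  calc ‖F s * G s‖ = ‖F s‖ * ‖G s‖ := norm_mul _ _
    _ ≤ (C * (2 + |s.im|) ^ A) * (D * (2 + |s.im|) ^ B) := by
      have := hF s hs
      have := hG s hs
      gcongr
    _ = _ := by ring

lemma PG.neg {S : Set ℂ} {F : ℂ → ℂ} (hF : PG S F) : PG S (fun s => -F s) := by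
  obtain ⟨C, hC, A, hF⟩ := hF
  exact ⟨C, hC, A, fun s hs => by simpa using hF s hs⟩

lemma PG.deriv {a b : ℝ} {F : ℂ → ℂ} (hF : PG (strip a b) F) (hd : Differentiable ℂ F) :
    PG (strip (a + 1/4) (b - 1/4)) (deriv F) := by
  obtain ⟨C, hC, A, hF⟩ := hF
  refine ⟨C * 2 ^ A * 4, by positivity, A, fun s hs => ?_⟩
  have h1 : ∀ z ∈ Metric.sphere s (1/4), ‖F z‖ ≤ C * (2 * (2 + |s.im|)) ^ A := by
    intro z hz
    rw [mem_sphere_iff_norm] at hz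
    have hre : |(z - s).re| ≤ 1/4 := (abs_re_le_norm _).trans hz.le
    have him : |(z - s).im| ≤ 1/4 := (abs_im_le_norm _).trans hz.le
    rw [sub_re, abs_le] at hre
    rw [sub_im] at him
    have h3 : |z.im| ≤ |s.im| + 1/4 := by
      have := abs_sub_abs_le_abs_sub z.im s.im
      linarith
    refine (hF z ⟨by linarith [hs.1], by linarith [hs.2]⟩).trans ?_
    gcongr
    linarith [abs_nonneg s.im]
  have h2 := norm_deriv_le_of_forall_mem_sphere_norm_le (c := s) (R := 1/4) (by norm_num)
    hd.diffContOnCl h1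
  refine h2.trans (le_of_eq ?_)
  rw [mul_pow]; ring

lemma inv_PG {E : ℂ → ℂ} (hd : Differentiable ℂ E) (hPG : PG (strip (1/2) 3) E)
    (hnz : ∀ s : ℂ, 1 ≤ s.re → E s ≠ 0)
    (h341 : ∃ c : ℝ, 0 < c ∧ ∃ B : ℕ, ∀ x y : ℝ, 0 < x → x ≤ 1 → 1 ≤ |y| →
      c * x ^ 3 ≤ ‖E (1 + x + I * y)‖ ^ 4 * (2 + |y|) ^ B) :
    PG (strip 1 2) (fun s => (E s)⁻¹) := by
  obtain ⟨c0, hc0, B, h341⟩ := h341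
  obtain ⟨C0, hC0, A, hE'⟩ := (hPG.deriv hd).mono (strip_mono (a := 1) (b := 2) (by norm_num) (by norm_num))
  obtain ⟨c, hc, hc1, hcc⟩ : ∃ c : ℝ, 0 < c ∧ c ≤ 1 ∧ c ≤ c0 := ⟨min c0 1, by positivity, by simp, by simp⟩
  obtain ⟨C, hC1, hCC⟩ : ∃ C : ℝ, 1 ≤ C ∧ C0 ≤ C := ⟨max C0 1, by simp, by simp⟩
  -- compact part
  have hK : IsCompact ((Icc 1 2 : Set ℝ) ×ℂ (Icc (-1) 1 : Set ℝ)) := isCompact_Icc.reProdIm isCompact_Icc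
  obtain ⟨D, hD⟩ := hK.exists_bound_of_continuousOn (f := fun s => (E s)⁻¹)
    (ContinuousOn.inv₀ hd.continuous.continuousOn (fun s hs => hnz s (by
      rw [mem_reProdIm] at hs; exact hs.1.1)))
  refine ⟨|D| + 2 * (2 * C) ^ 3 / c ^ 4, by positivity, B + 3 * (A + B), fun s hs => ?_⟩
  have hT : (1:ℝ) ≤ 2 + |s.im| := by linarith [abs_nonneg s.im]
  by_cases ht : |s.im| ≤ 1
  · have h1 := hD s (by rw [mem_reProdIm]; exact ⟨hs, abs_le.mp ht⟩)
    have h2 : (1:ℝ) ≤ (2 + |s.im|) ^ (B + 3 * (A + B)) := one_le_pow₀ hT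
    have h3 : 0 ≤ 2 * (2 * C) ^ 3 / c ^ 4 := by positivity
    calc ‖(E s)⁻¹‖ ≤ |D| := h1.trans (le_abs_self _)
      _ ≤ (|D| + 2 * (2 * C) ^ 3 / c ^ 4) * 1 := by linarith
      _ ≤ _ := by gcongr
  · push Not at ht
    set T : ℝ := 2 + |s.im| with hTdef
    have hT0 : 0 < T := by linarith
    set h0 : ℝ := c / (2 * C * T ^ (A + B)) with hh0
    have hh0pos : 0 < h0 := by positivity
    have hTA : 1 ≤ T ^ (A + B) := one_le_pow₀ hT
    have hh0le : h0 ≤ 1 := by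
      rw [hh0, div_le_one (by positivity)]
      nlinarith
    have main : ∀ x : ℝ, h0 ^ 4 ≤ x → x ≤ 1 → c * h0 ^ 3 / T ^ B ≤ ‖E (1 + x + I * s.im)‖ := by
      intro x hx hx1
      have hx0 : 0 < x := lt_of_lt_of_le (by positivity) hx
      have h1 := h341 x s.im hx0 hx1 ht.le
      refine le_of_pow_le_pow_left₀ (n := 4) (by norm_num) (norm_nonneg _) ?_
      have h2 : c * (h0^4)^3 / T ^ B ≤ ‖E (1 + x + I * s.im)‖ ^ 4 := by
        rw [div_le_iff₀ (by positivity)]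
        refine le_trans ?_ h1
        gcongr
      refine le_trans ?_ h2
      have e1 : (c * h0 ^ 3 / T ^ B) ^ 4 = (c * (h0^4)^3 / T ^ B) * (c ^ 3 * (1 / (T ^ B) ^ 3)) := by
        field_simp
      rw [e1]
      have h3 : c ^ 3 ≤ 1 := pow_le_one₀ hc.le hc1
      have h4 : 1 / (T ^ B) ^ 3 ≤ 1 := by
        rw [div_le_one (by positivity)]
        exact one_le_pow₀ (one_le_pow₀ hT)
      have h5 : c ^ 3 * (1 / (T ^ B) ^ 3) ≤ 1 := mul_le_one₀ h3 (by positivity) h4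
      have h6 : 0 ≤ c * (h0^4)^3 / T ^ B := by positivity
      exact mul_le_of_le_one_right h6 h5
    have low : c * h0 ^ 3 / T ^ B / 2 ≤ ‖E s‖ := by
      by_cases hσ : h0 ^ 4 ≤ s.re - 1
      · have h1 := main (s.re - 1) hσ (by linarith [hs.2])
        have e : (1 + ((s.re - 1 : ℝ) : ℂ) + I * s.im) = s := by
          apply Complex.ext <;> simp
        rw [e] at h1
        have : 0 ≤ c * h0 ^ 3 / T ^ B := by positivity
        linarith
      · push Not at hσ
        have h41 : h0 ^ 4 ≤ 1 := pow_le_one₀ hh0pos.le hh0le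
        have h1 := main (h0^4) le_rfl h41
        set s' : ℂ := (1 + ((h0^4 : ℝ) : ℂ) + I * s.im) with hs'
        have hre : s'.re = 1 + h0^4 := by rw [hs']; simp [← ofReal_pow]
        have him : s'.im = s.im := by rw [hs']; simp [← ofReal_pow]
        have hconv : Convex ℝ (strip 1 2 ∩ {z : ℂ | z.im = s.im}) := by
          refine Convex.inter (Convex.inter ?_ ?_) ?_
          · exact convex_halfSpace_re_ge 1
          · exact convex_halfSpace_re_le 2
          · intro x hx y hy a b ha hb hab
            simp only [mem_setOf_eq] at *
            simp [hx, hy, ← add_mul, hab]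
        have h2 : ‖E s - E s'‖ ≤ (C * T ^ A) * ‖s - s'‖ := by
          refine hconv.norm_image_sub_le_of_norm_deriv_le (𝕜 := ℂ) (fun z _ => hd z) ?_ ?_ ?_
          · intro z hz
            have := hE' z hz.1
            rw [show |z.im| = |s.im| by rw [hz.2]] at this
            refine this.trans ?_
            gcongr
          · exact ⟨⟨by rw [hre]; linarith [pow_pos hh0pos 4], by rw [hre]; linarith⟩, him⟩
          · exact ⟨hs, rfl⟩
        have h3 : ‖s - s'‖ ≤ h0 ^ 4 := by
          have e : s - s' = ((s.re - 1 - h0^4 : ℝ) : ℂ) := by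
            apply Complex.ext
            · rw [sub_re, hre, ofReal_re]; ring
            · rw [sub_im, him, ofReal_im]; ring
          rw [e, norm_real, Real.norm_eq_abs, abs_le]
          constructor <;> linarith [hs.1]
        have h4 : (C * T ^ A) * h0 ^ 4 = c * h0 ^ 3 / T ^ B / 2 := by
          have : h0 ^ 4 = h0 ^ 3 * (c / (2 * C * T ^ (A + B))) := by rw [← hh0]; ring
          rw [this, pow_add]
          field_simp
        have h5 : ‖E s - E s'‖ ≤ c * h0 ^ 3 / T ^ B / 2 := by
          rw [← h4]
          refine h2.trans ?_
          gcongr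
        have h6 : ‖E s'‖ ≤ ‖E s - E s'‖ + ‖E s‖ := by
          have := norm_sub_le (E s) (E s - E s')
          rw [sub_sub_cancel] at this
          linarith
        linarith
    rw [norm_inv]
    have hpos : 0 < c * h0 ^ 3 / T ^ B / 2 := by positivity
    refine (inv_anti₀ hpos low).trans ?_
    have e : (c * h0 ^ 3 / T ^ B / 2)⁻¹ = (2 * (2 * C) ^ 3 / c ^ 4) * T ^ (B + 3 * (A + B)) := by
      rw [hh0, pow_add T B, pow_mul' T 3]
      field_simp
    rw [e]
    have : 0 ≤ |D| := abs_nonneg _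
    gcongr
    linarith

lemma triv_bound {d : ℕ} [NeZero d] {s : ℂ} (hs1 : 1 < s.re) :
    ‖DirichletCharacter.LFunctionTrivChar d s‖ ≤ 2 ^ d.primeFactors.card * (‖s - 1‖⁻¹ + (1 + ‖s‖)) := by
  have hne : s ≠ 1 := by rintro rfl; simp at hs1
  rw [DirichletCharacter.LFunctionTrivChar_eq_mul_riemannZeta hne, norm_mul]
  refine mul_le_mul ?_ ?_ (norm_nonneg _) (by positivity)
  · rw [norm_prod]
    refine (Finset.prod_le_prod (fun _ _ => norm_nonneg _) (g := fun _ => (2:ℝ)) ?_).trans (by simp)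
    intro p hp
    have hp' := Nat.pos_of_mem_primeFactors hp
    refine (norm_sub_le _ _).trans ?_
    rw [norm_one, norm_natCast_cpow_of_pos hp']
    have : (p:ℝ) ^ (-s).re ≤ 1 := Real.rpow_le_one_of_one_le_of_nonpos (by exact_mod_cast hp') (by simp; linarith)
    linarith
  · rw [riemannZeta_eq_inv_sub_add hne]
    refine (norm_add_le _ _).trans ?_
    rw [norm_inv]
    gcongr
    refine (zeta0_bound (by linarith)).trans ?_
    have : 1 / s.re ≤ 1 := by rw [div_le_one (by linarith)]; linarith
    have := mul_le_of_le_one_right (norm_nonneg s) this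
    linarith

lemma triv_bound_real {d : ℕ} [NeZero d] {x : ℝ} (hx : 0 < x) (hx1 : x ≤ 1) :
    ‖DirichletCharacter.LFunctionTrivChar d (1 + x)‖ ≤ 2 ^ d.primeFactors.card * (4 / x) := by
  refine (triv_bound (by simpa using hx)).trans ?_
  gcongr
  have h1 : ‖(1 + (x:ℂ)) - 1‖ = x := by simp [abs_of_pos hx]
  have h2 : ‖(1 + (x:ℂ))‖ ≤ 2 := by
    refine (norm_add_le _ _).trans ?_
    simp [abs_of_pos hx]; linarith
  rw [h1]
  have : 1 ≤ x⁻¹ := (one_le_inv₀ hx).mpr hx1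
  rw [div_eq_mul_inv]; linarith

lemma triv_bound_im {d : ℕ} [NeZero d] {x y : ℝ} (hx : 0 < x) (hx1 : x ≤ 1) (hy : 1 ≤ |y|) :
    ‖DirichletCharacter.LFunctionTrivChar d (1 + x + 2 * I * y)‖ ≤
      2 ^ d.primeFactors.card * (2 * (2 + |y|)) := by
  refine (triv_bound (by simpa using hx)).trans ?_
  gcongr
  have h1 : 1 ≤ ‖(1 + (x:ℂ) + 2 * I * y) - 1‖ := by
    refine le_trans ?_ (abs_im_le_norm _)
    simp [abs_mul]; linarith
  have h2 : ‖(1 + (x:ℂ) + 2 * I * y)‖ ≤ 2 + 2 * |y| := by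
    refine (norm_add_le _ _).trans ?_
    have : ‖(1 + (x:ℂ))‖ ≤ 2 := by
      refine (norm_add_le _ _).trans ?_
      simp [abs_of_pos hx]; linarith
    have h3 : ‖2 * I * (y:ℂ)‖ = 2 * |y| := by simp
    rw [h3]; linarith
  have := inv_le_one_of_one_le₀ h1
  linarith

lemma L341 {d : ℕ} [NeZero d] (χ : DirichletCharacter ℂ d) (h2 : χ ^ 2 = 1) :
    ∃ c : ℝ, 0 < c ∧ ∃ B : ℕ, ∀ x y : ℝ, 0 < x → x ≤ 1 → 1 ≤ |y| →
      c * x ^ 3 ≤ ‖DirichletCharacter.LFunction χ (1 + x + I * y)‖ ^ 4 * (2 + |y|) ^ B := by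
  set P : ℝ := 2 ^ d.primeFactors.card with hP
  have hPpos : 0 < P := by positivity
  refine ⟨1 / ((P * 4) ^ 3 * (P * 2)), by positivity, 1, fun x y hx hx1 hy => ?_⟩
  have h := DirichletCharacter.norm_LFunction_product_ge_one χ hx y
  rw [h2, norm_mul, norm_mul, norm_pow, norm_pow] at h
  have h3 := triv_bound_real (d := d) hx hx1
  have h4 := triv_bound_im (d := d) hx hx1 hy
  have h5 : (1:ℝ) ≤ (P * (4/x)) ^ 3 * ‖DirichletCharacter.LFunction χ (1 + x + I * y)‖ ^ 4 *
      (P * (2 * (2 + |y|))) := by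
    refine h.le.trans ?_
    gcongr
  rw [div_mul_eq_mul_div, div_le_iff₀ (by positivity), pow_one]
  have : 1 * x ^ 3 ≤ ((P * (4/x)) ^ 3 * ‖DirichletCharacter.LFunction χ (1 + x + I * y)‖ ^ 4 *
      (P * (2 * (2 + |y|)))) * x ^ 3 := by gcongr
  refine this.trans (le_of_eq ?_)
  field_simp

lemma strip_norm {s : ℂ} (hs : s ∈ strip (1/2) 3) : ‖s‖ ≤ 2 * (2 + |s.im|) := by
  refine (norm_le_abs_re_add_abs_im s).trans ?_
  rw [abs_of_pos (by linarith [hs.1])]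
  linarith [hs.2, abs_nonneg s.im]

lemma L_PG {d : ℕ} [NeZero d] {χ : DirichletCharacter ℂ d} (hχ : χ ≠ 1) :
    PG (strip (1/2) 3) (DirichletCharacter.LFunction χ) := by
  refine ⟨4 * (d + 1), by positivity, 1, fun s hs => ?_⟩
  have h0 : 0 < s.re := by linarith [hs.1]
  refine (LFun_bound hχ h0).trans ?_
  have h1 : (d+1:ℝ) / s.re ≤ 2 * (d + 1) := by
    rw [div_le_iff₀ h0]; nlinarith [hs.1, Nat.cast_nonneg (α := ℝ) d]
  calc ‖s‖ * ((d+1:ℝ) / s.re) ≤ (2 * (2 + |s.im|)) * (2 * (d + 1)) := by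
        gcongr; exact strip_norm hs
    _ = _ := by ring

lemma zeta0_PG : PG (strip (1/2) 3) riemannZeta₀ := by
  refine ⟨5, by positivity, 1, fun s hs => ?_⟩
  have h0 : 0 < s.re := by linarith [hs.1]
  refine (zeta0_bound h0).trans ?_
  have h1 : (1:ℝ) / s.re ≤ 2 := by
    rw [div_le_iff₀ h0]; linarith [hs.1]
  have : ‖s‖ * (1 / s.re) ≤ (2 * (2 + |s.im|)) * 2 := by
    gcongr; exact strip_norm hs
  rw [pow_one]
  linarith [abs_nonneg s.im]

lemma zeta1_PG : PG (strip (1/2) 3) riemannZeta₁ := by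
  have h1 : PG (strip (1/2) 3) (fun _ => 1) := ⟨1, by norm_num, 0, by simp⟩
  have h2 : PG (strip (1/2) 3) (fun s => s - 1) := by
    refine ⟨3, by norm_num, 1, fun s hs => ?_⟩
    refine (norm_sub_le _ _).trans ?_
    have := strip_norm hs
    rw [norm_one, pow_one]
    linarith [abs_nonneg s.im]
  exact h1.add (h2.mul zeta0_PG)

lemma zeta1_ne {s : ℂ} (hs : 1 ≤ s.re) : riemannZeta₁ s ≠ 0 := by
  by_cases h : s = 1
  · simp [h]
  · have := riemannZeta_ne_zero_of_one_le_re hs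
    rw [riemannZeta_eq_inv_sub_mul h] at this
    exact right_ne_zero_of_mul this

lemma zeta1_341 : ∃ c : ℝ, 0 < c ∧ ∃ B : ℕ, ∀ x y : ℝ, 0 < x → x ≤ 1 → 1 ≤ |y| →
      c * x ^ 3 ≤ ‖riemannZeta₁ (1 + x + I * y)‖ ^ 4 * (2 + |y|) ^ B := by
  obtain ⟨c, hc, B, h⟩ := L341 (d := 1) 1 (by simp)
  refine ⟨c, hc, B, fun x y hx hx1 hy => (h x y hx hx1 hy).trans ?_⟩
  gcongr
  rw [DirichletCharacter.LFunction_modOne_eq]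
  have h1 : 1 ≤ ‖(1 + (x:ℂ) + I * y) - 1‖ := by
    refine le_trans ?_ (abs_im_le_norm _)
    simpa using hy
  have hne : (1 + (x:ℂ) + I * y) ≠ 1 := by
    intro h0
    rw [h0] at h1; simp at h1
    linarith
  rw [riemannZeta_eq_inv_sub_mul hne, norm_mul, norm_inv]
  exact mul_le_of_le_one_left (norm_nonneg _) (inv_le_one_of_one_le₀ h1)

/-- The derivative of the logarithmic derivative has polynomial growth. -/
lemma logDeriv_PG {E K : ℂ → ℂ} {a : ℕ → ℂ} (hE : Differentiable ℂ E) (hK : Differentiable ℂ K)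
    (hEPG : PG (strip (1/2) 3) E) (hKPG : PG (strip (1/2) 3) K)
    (hnz : ∀ s : ℂ, 1 ≤ s.re → E s ≠ 0)
    (h341 : ∃ c : ℝ, 0 < c ∧ ∃ B : ℕ, ∀ x y : ℝ, 0 < x → x ≤ 1 → 1 ≤ |y| →
      c * x ^ 3 ≤ ‖E (1 + x + I * y)‖ ^ 4 * (2 + |y|) ^ B)
    (ha : LSeries.abscissaOfAbsConv a ≤ 1)
    (heq : ∀ s : ℂ, 1 < s.re → LSeries a s = -deriv E s / E s - K s) :
    PG {s | 1 < s.re ∧ s.re ≤ 2} (LSeries (LSeries.logMul a)) := by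
  have hS : {s : ℂ | 1 < s.re ∧ s.re ≤ 2} ⊆ strip 1 2 := fun s hs => ⟨hs.1.le, hs.2⟩
  have i := (inv_PG hE hEPG hnz h341).mono hS
  have hE'd : Differentiable ℂ (deriv E) := hE.deriv
  have e0 : PG {s : ℂ | 1 < s.re ∧ s.re ≤ 2} E :=
    hEPG.mono (hS.trans (strip_mono (by norm_num) (by norm_num)))
  have e1 := hEPG.deriv hE
  have e2 := (e1.deriv hE'd).mono (hS.trans (strip_mono (by norm_num) (by norm_num)))
  have e1' := e1.mono (hS.trans (strip_mono (by norm_num) (by norm_num)))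
  have k1 := (hKPG.deriv hK).mono (hS.trans (strip_mono (by norm_num) (by norm_num)))
  have hall := (((((e2.mul e0).neg).add (e1'.mul e1')).mul (i.mul i)).add k1.neg).neg
  obtain ⟨C, hC, A, h⟩ := hall
  refine ⟨C, hC, A, fun s hs => ?_⟩
  have hab : LSeries.abscissaOfAbsConv a < s.re :=
    lt_of_le_of_lt ha (by exact_mod_cast hs.1)
  have h1 := LSeries_deriv hab
  have h2 : deriv (LSeries a) s = deriv (fun s => -deriv E s / E s - K s) s := by
    refine EventuallyEq.deriv_eq ?_
    have : {s : ℂ | 1 < s.re} ∈ 𝓝 s := (isOpen_lt continuous_const continuous_re).mem_nhds hs.1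
    filter_upwards [this] with z hz using heq z hz
  have hne := hnz s hs.1.le
  have h3 : HasDerivAt (fun s => -deriv E s / E s - K s)
      ((-deriv (deriv E) s * E s - (-deriv E s) * deriv E s) / (E s) ^ 2 - deriv K s) s :=
    (((hE'd s).hasDerivAt.neg).div (hE s).hasDerivAt hne).sub (hK s).hasDerivAt
  have h4 : LSeries (LSeries.logMul a) s =
      -((-(deriv (deriv E) s * E s) + deriv E s * deriv E s) * ((E s)⁻¹ * (E s)⁻¹) + -deriv K s) := by
    rw [← neg_eq_iff_eq_neg.mpr h1, h2, h3.deriv]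
    field_simp
    ring
  rw [h4]
  exact h s hs

lemma zeta_PG : PG {s | 1 < s.re ∧ s.re ≤ 2}
    (LSeries (LSeries.logMul (fun n => ((ArithmeticFunction.vonMangoldt n : ℝ) : ℂ) - 1))) := by
  have hsum : ∀ s : ℂ, 1 < s.re →
      LSeriesSummable (fun n => ((ArithmeticFunction.vonMangoldt n : ℝ) : ℂ) - 1) s := fun s hs =>
    (ArithmeticFunction.LSeriesSummable_vonMangoldt hs).sub (LSeriesSummable_one_iff.mpr hs)
  refine logDeriv_PG differentiable_riemannZeta₁ differentiable_riemannZeta₀ zeta1_PG zeta0_PG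
    (fun s hs => zeta1_ne hs) zeta1_341 ?_ ?_
  · exact LSeries.abscissaOfAbsConv_le_of_forall_lt_LSeriesSummable fun y hy => hsum y (by simpa using hy)
  · intro s hs
    have hne : s ≠ 1 := by rintro rfl; simp at hs
    have hne' : s - 1 ≠ 0 := sub_ne_zero.mpr hne
    have h1 := LSeries_sub (ArithmeticFunction.LSeriesSummable_vonMangoldt hs) (LSeriesSummable_one_iff.mpr hs)
    have h2 : (fun n => ((ArithmeticFunction.vonMangoldt n : ℝ) : ℂ) - 1) =
      (fun n => ((ArithmeticFunction.vonMangoldt n : ℝ) : ℂ)) - 1 := rfl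
    rw [h2, h1, ArithmeticFunction.LSeries_vonMangoldt_eq_deriv_riemannZeta_div hs,
      LSeries_one_eq_riemannZeta hs, deriv_riemannZeta_eq_neg_inv_sub_sq_mul_add hne,
      ]
    have h3 := riemannZeta_eq_inv_sub_mul hne
    have h4 := riemannZeta_eq_inv_sub_add hne
    have h5 := zeta1_ne hs.le
    conv_lhs => 
      enter [2]
      rw [h4]
    rw [h3]
    field_simp
    ring

lemma chi_PG {d : ℕ} [NeZero d] {χ : DirichletCharacter ℂ d} (hχ : χ ≠ 1) (h2 : χ ^ 2 = 1) :
    PG {s | 1 < s.re ∧ s.re ≤ 2}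
    (LSeries (LSeries.logMul (fun n => χ n * ((ArithmeticFunction.vonMangoldt n : ℝ) : ℂ)))) := by
  refine logDeriv_PG (E := DirichletCharacter.LFunction χ) (K := fun _ => 0)
    (DirichletCharacter.differentiable_LFunction hχ) (by fun_prop) (L_PG hχ)
    ⟨0, le_rfl, 0, by simp⟩
    (fun s hs => DirichletCharacter.LFunction_ne_zero_of_one_le_re χ (Or.inl hχ) hs) (L341 χ h2) ?_ ?_
  · exact LSeries.abscissaOfAbsConv_le_of_forall_lt_LSeriesSummable fun y hy =>
      DirichletCharacter.LSeriesSummable_twist_vonMangoldt χ (s := y) (by simpa using hy)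
  · intro s hs
    rw [sub_zero, DirichletCharacter.deriv_LFunction_eq_deriv_LSeries χ hs,
      DirichletCharacter.LFunction_eq_LSeries χ hs]
    exact DirichletCharacter.LSeries_twist_vonMangoldt_eq χ hs

end DGK

namespace DGK
open Complex MeasureTheory Set Topology

/-- Smooth cutoff `(1-t)_+^k`. -/
noncomputable def ff (k : ℕ) (t : ℝ) : ℂ := ((max (1 - t) 0 : ℝ) : ℂ) ^ k

lemma ff_cont (k : ℕ) : Continuous (ff k) := by unfold ff; fun_prop

lemma ff_zero {k : ℕ} (hk : k ≠ 0) {t : ℝ} (ht : 1 ≤ t) : ff k t = 0 := by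
  rw [ff, max_eq_right (by linarith)]; simp [hk]

lemma ff_conv (k : ℕ) (hk : k ≠ 0) {s : ℂ} (hs : 0 < s.re) : MellinConvergent (ff k) s := by
  have h := betaIntegral_convergent hs (v := (k:ℂ) + 1) (by simp; positivity)
  rw [intervalIntegrable_iff_integrableOn_Ioc_of_le zero_le_one] at h
  have h2 : IntegrableOn (fun t : ℝ => (t : ℂ) ^ (s - 1) • ff k t) (Ioc 0 1) := by
    refine h.congr_fun (fun t ht => ?_) measurableSet_Ioc
    simp only [add_sub_cancel_right, cpow_natCast, ff, smul_eq_mul]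
    rw [max_eq_left (by linarith [ht.2])]; push_cast; rfl
  refine h2.of_forall_sdiff_eq_zero measurableSet_Ioi fun t ht => ?_
  have : 1 ≤ t := by
    by_contra hlt
    exact ht.2 ⟨ht.1, by linarith⟩
  simp [ff_zero hk this]

lemma ff_mellin (k : ℕ) (hk : k ≠ 0) {s : ℂ} (hs : 0 < s.re) :
    mellin (ff k) s = (k.factorial : ℂ) / ∏ j ∈ Finset.range (k + 1), (s + j) := by
  rw [← betaIntegral_eval_nat_add_one_right hs, mellin, betaIntegral,
    intervalIntegral.integral_of_le zero_le_one]
  rw [setIntegral_eq_of_subset_of_forall_sdiff_eq_zero (s := Ioc (0:ℝ) 1) (t := Ioi 0) measurableSet_Ioi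
    (fun t ht => ht.1)]
  · refine setIntegral_congr_fun measurableSet_Ioc (fun t ht => ?_)
    simp only [add_sub_cancel_right, cpow_natCast, ff, smul_eq_mul]
    rw [max_eq_left (by linarith [ht.2])]; push_cast; rfl
  · intro t ht
    have : 1 ≤ t := by
      by_contra hlt
      exact ht.2 ⟨ht.1, by linarith⟩
    simp [ff_zero hk this]

lemma ff_mellin_norm (k : ℕ) (hk : k ≠ 0) {s : ℂ} (hs : 1 ≤ s.re) :
    ‖mellin (ff k) s‖ ≤ (k.factorial * 3 ^ (k + 1)) / (2 + |s.im|) ^ (k + 1) := by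
  rw [ff_mellin k hk (by linarith), norm_div, norm_prod, norm_natCast, mul_div_assoc, ← div_pow,
    div_eq_mul_inv]
  gcongr
  rw [← inv_inv ((3:ℝ) / _), inv_pow, inv_div]
  refine inv_anti₀ (by positivity) ?_
  rw [← Finset.card_range (k+1), ← Finset.prod_const, Finset.card_range]
  refine Finset.prod_le_prod (fun _ _ => by positivity) fun j _ => ?_
  have h1 : |(s + j).re| ≤ ‖s + j‖ := abs_re_le_norm _
  have h2 : |(s + j).im| ≤ ‖s + j‖ := abs_im_le_norm _
  simp only [add_re, natCast_re, add_im, natCast_im, add_zero] at h1 h2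
  rw [abs_of_nonneg (by positivity)] at h1
  have : (0:ℝ) ≤ j := by positivity
  linarith

lemma int_inv_sq : Integrable (fun t : ℝ => 1 / (2 + |t|) ^ 2) := by
  refine (integrable_inv_one_add_sq).mono' ?_ (Eventually.of_forall fun t => ?_)
  · refine Continuous.aestronglyMeasurable ?_
    refine continuous_const.div (by fun_prop) fun t => ?_
    positivity
  · rw [Real.norm_of_nonneg (by positivity), one_div]
    gcongr
    rw [← sq_abs t]
    nlinarith [abs_nonneg t]

lemma ff_cont_vert (k : ℕ) (hk : k ≠ 0) {σ : ℝ} (hs : 1 ≤ σ) :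
    Continuous (fun t : ℝ => mellin (ff k) (σ + t * I)) := by
  have : (fun t : ℝ => mellin (ff k) (σ + t * I)) = fun t : ℝ =>
      (k.factorial : ℂ) / ∏ j ∈ Finset.range (k + 1), ((σ + t * I) + j) := by
    ext t
    rw [ff_mellin k hk (by simp; linarith)]
  rw [this]
  refine continuous_const.div (by fun_prop) fun t => ?_
  rw [Finset.prod_ne_zero_iff]
  intro j _ h
  have := congrArg re h
  simp at this
  have : (0:ℝ) ≤ j := by positivity
  linarith

lemma ff_vert_bound (k : ℕ) (hk : k ≠ 0) {σ : ℝ} (hs : 1 ≤ σ) (t : ℝ) :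
    ‖mellin (ff k) (σ + t * I)‖ ≤ (k.factorial * 3 ^ (k + 1)) * (1 / (2 + |t|) ^ 2) := by
  have := ff_mellin_norm k hk (s := σ + t * I) (by simpa using hs)
  simp only [add_im, ofReal_im, mul_im, ofReal_re, I_im, mul_one, I_re, mul_zero, add_zero, zero_add] at this
  refine this.trans ?_
  rw [mul_one_div]
  gcongr
  · linarith [abs_nonneg t]
  · omega

lemma ff_vert (k : ℕ) (hk : k ≠ 0) {σ : ℝ} (hs : 1 ≤ σ) : VerticalIntegrable (mellin (ff k)) σ := by
  refine (int_inv_sq.const_mul (k.factorial * 3 ^ (k + 1))).mono' (ff_cont_vert k hk hs).aestronglyMeasurable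
    (Eventually.of_forall fun t => ff_vert_bound k hk hs t)

lemma ff_inv (k : ℕ) (hk : k ≠ 0) {σ : ℝ} (hs : 1 ≤ σ) {x : ℝ} (hx : 0 < x) :
    ∫ t : ℝ, (x : ℂ) ^ (-(σ + t * I)) * mellin (ff k) (σ + t * I) = (2 * Real.pi) * ff k x := by
  have := mellinInv_mellin_eq σ (ff k) hx (ff_conv k hk (by simp; linarith)) (ff_vert k hk hs)
    (ff_cont k).continuousAt
  rw [mellinInv] at this
  simp only [smul_eq_mul] at this
  rw [← this]
  rw [Complex.real_smul]
  have : (Real.pi : ℂ) ≠ 0 := by exact_mod_cast Real.pi_ne_zero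
  rw [← mul_assoc]
  have e : (2 * (Real.pi:ℂ)) * ((1 / (2 * Real.pi) : ℝ) : ℂ) = 1 := by
    push_cast; field_simp
  rw [e, one_mul]

lemma perron (k : ℕ) (hk : k ≠ 0) {σ : ℝ} (hs : 1 ≤ σ) {b : ℕ → ℂ} (hb0 : b 0 = 0) (hb : LSeriesSummable b σ)
    {X : ℝ} (hX : 0 < X) :
    HasSum (fun n : ℕ => (2 * Real.pi) * (b n * ff k (n / X)))
      (∫ t : ℝ, LSeries b (σ + t * I) * ((X : ℂ) ^ ((σ:ℂ) + t * I) * mellin (ff k) (σ + t * I))) := by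
  have hX0 : (X:ℂ) ≠ 0 := by exact_mod_cast hX.ne'
  have hg : Integrable (fun t : ℝ => (X : ℂ) ^ ((σ:ℂ) + t * I) * mellin (ff k) (σ + t * I)) := by
    refine ((ff_vert k hk hs).norm.const_mul (X ^ σ)).mono' ?_ (Eventually.of_forall fun t => ?_)
    · refine Continuous.aestronglyMeasurable ?_
      refine Continuous.mul ?_ (ff_cont_vert k hk hs)
      exact Continuous.const_cpow (by fun_prop) (Or.inl hX0)
    · rw [norm_mul, norm_cpow_eq_rpow_re_of_pos hX]
      simp
  have hterm (n : ℕ) (t : ℝ) : ‖LSeries.term b (σ + t * I) n‖ = ‖LSeries.term b σ n‖ := by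
    rw [LSeries.norm_term_eq, LSeries.norm_term_eq]; simp
  have key := hasSum_integral_of_summable_integral_norm (μ := volume) (ι := ℕ)
    (F := fun n (t : ℝ) => LSeries.term b (σ + t * I) n * ((X : ℂ) ^ ((σ:ℂ) + t * I) * mellin (ff k) (σ + t * I))) ?_ ?_
  · suffices e1 : (fun n : ℕ => (2 * Real.pi) * (b n * ff k (n / X))) = fun n : ℕ => ∫ t : ℝ,
        LSeries.term b (σ + t * I) n * ((X : ℂ) ^ ((σ:ℂ) + t * I) * mellin (ff k) (σ + t * I)) by
      rw [e1]
      have e2 : ∀ t : ℝ, ∑' n : ℕ, LSeries.term b (σ + t * I) n *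
          ((X : ℂ) ^ ((σ:ℂ) + t * I) * mellin (ff k) (σ + t * I)) =
          LSeries b (σ + t * I) * ((X : ℂ) ^ ((σ:ℂ) + t * I) * mellin (ff k) (σ + t * I)) := by
        intro t
        rw [tsum_mul_right]; rfl
      simp_rw [e2] at key
      exact key
    · ext n
      rcases eq_or_ne n 0 with rfl | hn
      · simp [hb0]
      · have hn' : (0:ℝ) < n := by exact_mod_cast Nat.pos_of_ne_zero hn
        have hn0 : (n:ℂ) ≠ 0 := by exact_mod_cast hn
        have e : ∀ t : ℝ, LSeries.term b (σ + t * I) n * ((X : ℂ) ^ ((σ:ℂ) + t * I) * mellin (ff k) (σ + t * I))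
            = b n * (((n / X : ℝ) : ℂ) ^ (-((σ:ℂ) + t * I)) * mellin (ff k) (σ + t * I)) := by
          intro t
          rw [LSeries.term_of_ne_zero hn, ofReal_div, div_eq_mul_inv ((n:ℝ):ℂ), ← ofReal_inv,
            mul_cpow_ofReal_nonneg hn'.le (by positivity), ofReal_inv, inv_cpow, cpow_neg, cpow_neg, inv_inv, ofReal_natCast]
          · ring
          · rw [arg_ofReal_of_nonneg hX.le]; exact Real.pi_pos.ne
        simp_rw [e]
        rw [integral_const_mul, ff_inv k hk hs (by positivity)]
        ring
  · intro n
    refine hg.bdd_mul (c := ‖LSeries.term b σ n‖) ?_ (Eventually.of_forall fun t => (hterm n t).le)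
    refine Continuous.aestronglyMeasurable ?_
    rcases eq_or_ne n 0 with rfl | hn
    · simp; fun_prop
    · have hn0 : (n:ℂ) ≠ 0 := by exact_mod_cast hn
      simp only [LSeries.term_of_ne_zero hn]
      refine continuous_const.div (Continuous.const_cpow (by fun_prop) (Or.inl hn0)) fun t => ?_
      simp [cpow_eq_zero_iff, hn0]
  · simp_rw [norm_mul (LSeries.term _ _ _), hterm, integral_const_mul]
    exact hb.norm.mul_right _

lemma smooth_bound {b : ℕ → ℂ} (hb0 : b 0 = 0) (hb : ∀ σ : ℝ, 1 < σ → LSeriesSummable b σ)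
    (hPG : PG {s | 1 < s.re ∧ s.re ≤ 2} (LSeries b)) :
    ∃ A : ℕ, ∀ k : ℕ, A ≤ k → k ≠ 0 ∧ ∃ C : ℝ, ∀ X : ℝ, 3 ≤ X → ‖∑' n : ℕ, b n * ff k (n / X)‖ ≤ C * X := by
  obtain ⟨C, hC, A, h⟩ := hPG
  refine ⟨A + 1, fun k hk => ?_⟩
  have hk0 : k ≠ 0 := by omega
  refine ⟨hk0, C * ((k.factorial * 3 ^ (k + 1))) * Real.exp 1 * ∫ t : ℝ, 1 / (2 + |t|) ^ 2, fun X hX => ?_⟩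
  have hlog : 1 ≤ Real.log X := by
    rw [Real.le_log_iff_exp_le (by linarith)]
    linarith [Real.exp_one_lt_d9]
  set σ : ℝ := 1 + 1 / Real.log X with hσ
  have hp : 0 < 1 / Real.log X := by positivity
  have hp2 : 1 / Real.log X ≤ 1 := by rw [div_le_one (by linarith)]; exact hlog
  have key := perron k hk0 (σ := σ) (by linarith) hb0 (hb σ (by linarith)) (X := X) (by linarith)
  have e := key.tsum_eq
  rw [tsum_mul_left] at e
  have hpi : ‖(2 * Real.pi : ℂ)‖ = 2 * Real.pi := by
    rw [norm_mul]; simp [abs_of_pos Real.pi_pos]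
  have hXσ : X ^ σ = X * Real.exp 1 := by
    rw [hσ, Real.rpow_add (by linarith), Real.rpow_one, Real.rpow_def_of_pos (by linarith)]
    congr 2
    field_simp
  have b1 : ‖∑' n : ℕ, b n * ff k (n / X)‖ ≤ ‖(2 * Real.pi : ℂ) * ∑' n : ℕ, b n * ff k (n / X)‖ := by
    rw [norm_mul, hpi]
    have : 1 ≤ 2 * Real.pi := by linarith [Real.pi_gt_three]
    exact le_mul_of_one_le_left (norm_nonneg _) this
  refine b1.trans ?_
  rw [e]
  have b2 : ∀ t : ℝ, ‖LSeries b (σ + t * I) * ((X : ℂ) ^ ((σ:ℂ) + t * I) * mellin (ff k) (σ + t * I))‖ ≤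
      (C * ((k.factorial * 3 ^ (k + 1))) * Real.exp 1 * X) * (1 / (2 + |t|) ^ 2) := by
    intro t
    rw [norm_mul, norm_mul, norm_cpow_eq_rpow_re_of_pos (by linarith)]
    have h1 := h (σ + t * I) ⟨by simp; linarith, by simp; linarith⟩
    have h2 := ff_mellin_norm k hk0 (s := σ + t * I) (by simp; linarith)
    have him : ((σ:ℂ) + t * I).im = t := by simp
    have hre : ((σ:ℂ) + t * I).re = σ := by simp
    rw [him] at h1 h2
    rw [hre, hXσ]
    have hT : 1 ≤ 2 + |t| := by linarith [abs_nonneg t]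
    calc _ ≤ (C * (2 + |t|) ^ A) * (X * Real.exp 1 * ((k.factorial * 3 ^ (k + 1)) / (2 + |t|) ^ (k + 1))) := by
          gcongr
      _ = (C * ((k.factorial * 3 ^ (k + 1))) * Real.exp 1 * X) * ((2 + |t|) ^ A / (2 + |t|) ^ (k + 1)) := by ring
      _ ≤ _ := by
          refine mul_le_mul_of_nonneg_left ?_ (by positivity)
          rw [div_le_div_iff₀ (by positivity) (by positivity), one_mul, ← pow_add]
          exact pow_le_pow_right₀ hT (by omega)
  refine (norm_integral_le_of_norm_le (int_inv_sq.const_mul _) (Eventually.of_forall b2)).trans ?_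
  rw [integral_const_mul]
  apply le_of_eq; ring

end DGK

namespace DGK
open Complex MeasureTheory Set Topology

/-- Riesz sums. -/
noncomputable def G (b : ℕ → ℝ) (j : ℕ) (x : ℝ) : ℝ := ∑ n ∈ Finset.range (⌊x⌋₊ + 1), b n * (x - n) ^ j

/-- Truncated power. -/
noncomputable def tp (j : ℕ) (u : ℝ) : ℝ := if 0 ≤ u then u ^ j else 0

lemma G_eq (b : ℕ → ℝ) (j : ℕ) {x : ℝ} (hx : 0 ≤ x) {M : ℕ} (hM : ⌊x⌋₊ + 1 ≤ M) :
    G b j x = ∑ n ∈ Finset.range M, b n * tp j (x - n) := by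
  rw [← Finset.sum_subset (Finset.range_mono hM)]
  · refine Finset.sum_congr rfl fun n hn => ?_
    rw [tp, if_pos]
    have : n ≤ ⌊x⌋₊ := by simpa [Nat.lt_succ_iff] using hn
    have := (Nat.le_floor_iff hx).mp this
    linarith
  · intro n _ hn
    have : ⌊x⌋₊ < n := by simpa [Nat.lt_succ_iff] using hn
    have := (Nat.floor_lt hx).mp this
    rw [tp, if_neg (by linarith), mul_zero]

lemma pow_diff {u v : ℝ} (hv : 0 ≤ v) (huv : v ≤ u) (j : ℕ) :
    (j + 1) * (u - v) * v ^ j ≤ u ^ (j + 1) - v ^ (j + 1) ∧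
    u ^ (j + 1) - v ^ (j + 1) ≤ (j + 1) * (u - v) * u ^ j := by
  induction j with
  | zero => simp
  | succ j ih =>
    obtain ⟨h1, h2⟩ := ih
    have hu : 0 ≤ u := hv.trans huv
    have e : u ^ (j + 1 + 1) - v ^ (j + 1 + 1) = u * (u ^ (j + 1) - v ^ (j + 1)) + v ^ (j + 1) * (u - v) := by ring
    have h3 : v ^ (j + 1) ≤ u ^ (j + 1) := pow_le_pow_left₀ hv huv _
    have h4 : 0 ≤ u - v := by linarith
    rw [e]
    push_cast
    constructor
    · have a1 : v * ((j + 1) * (u - v) * v ^ j) ≤ u * (u ^ (j + 1) - v ^ (j + 1)) :=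
        mul_le_mul huv h1 (by positivity) hu
      have : v * ((j + 1) * (u - v) * v ^ j) = (j + 1) * (u - v) * v ^ (j + 1) := by ring
      linarith
    · have a1 := mul_le_mul_of_nonneg_left h2 hu
      have a2 := mul_le_mul_of_nonneg_right h3 h4
      have : u * ((j + 1) * (u - v) * u ^ j) = (j + 1) * (u - v) * u ^ (j + 1) := by ring
      linarith

lemma tp_diff {u v : ℝ} (huv : v ≤ u) (j : ℕ) :
    (j + 1) * (u - v) * tp j v ≤ tp (j + 1) u - tp (j + 1) v ∧
    tp (j + 1) u - tp (j + 1) v ≤ (j + 1) * (u - v) * tp j u := by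
  unfold tp
  by_cases hv : 0 ≤ v
  · rw [if_pos hv, if_pos hv, if_pos (hv.trans huv), if_pos (hv.trans huv)]
    exact pow_diff hv huv j
  · rw [if_neg hv, if_neg hv]
    by_cases hu : 0 ≤ u
    · rw [if_pos hu, if_pos hu]
      refine ⟨by simp; positivity, ?_⟩
      have h0 : 0 ≤ u ^ j := by positivity
      have h1 : u ≤ (j + 1) * (u - v) := by
        have : (0:ℝ) ≤ j := by positivity
        push Not at hv
        nlinarith
      rw [sub_zero, pow_succ, mul_comm]
      gcongr
    · rw [if_neg hu, if_neg hu]; simp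

lemma G_diff {b : ℕ → ℝ} (hb : ∀ n, 0 ≤ b n) (j : ℕ) {x y : ℝ} (hy : 0 ≤ y) (hyx : y ≤ x) :
    (j + 1) * (x - y) * G b j y ≤ G b (j + 1) x - G b (j + 1) y ∧
    G b (j + 1) x - G b (j + 1) y ≤ (j + 1) * (x - y) * G b j x := by
  have hf : ⌊y⌋₊ + 1 ≤ ⌊x⌋₊ + 1 := Nat.add_le_add_right (Nat.floor_mono hyx) 1
  rw [G_eq b j hy hf, G_eq b (j+1) (hy.trans hyx) le_rfl, G_eq b (j+1) hy hf, G_eq b j (hy.trans hyx) le_rfl,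
    ← Finset.sum_sub_distrib, Finset.mul_sum, Finset.mul_sum]
  constructor
  · refine Finset.sum_le_sum fun n _ => ?_
    have := mul_le_mul_of_nonneg_left (tp_diff (u := x - n) (v := y - n) (by linarith) j).1 (hb n)
    have e : (x - n) - (y - n) = x - y := by ring
    rw [e] at this
    linarith
  · refine Finset.sum_le_sum fun n _ => ?_
    have := mul_le_mul_of_nonneg_left (tp_diff (u := x - n) (v := y - n) (by linarith) j).2 (hb n)
    have e : (x - n) - (y - n) = x - y := by ring
    rw [e] at this
    linarith

/-- Shifted logarithm. -/
noncomputable def ll (x : ℝ) : ℝ := 1 + Real.log (1 + x)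

lemma ll_one {x : ℝ} (hx : 0 ≤ x) : 1 ≤ ll x := by
  unfold ll; linarith [Real.log_nonneg (show 1 ≤ 1 + x by linarith)]

lemma ll_mono {x y : ℝ} (hx : 0 ≤ x) (hxy : x ≤ y) : ll x ≤ ll y := by
  unfold ll
  have := Real.log_le_log (show 0 < 1 + x by linarith) (show 1 + x ≤ 1 + y by linarith)
  linarith

lemma ll_le {x : ℝ} (hx : 0 ≤ x) : ll x ≤ 1 + x := by
  unfold ll; linarith [Real.log_le_sub_one_of_pos (show 0 < 1 + x by linarith)]

lemma ll_two {x : ℝ} (hx : 0 ≤ x) : ll (2 * x) ≤ 2 * ll x := by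
  unfold ll
  have h1 : Real.log (1 + 2 * x) ≤ Real.log ((1 + x) ^ 2) := Real.log_le_log (by linarith) (by nlinarith)
  rw [Real.log_pow] at h1
  push_cast at h1
  linarith

lemma log_le_ll {n : ℕ} {x : ℝ} (hn : (n:ℝ) ≤ x) : Real.log n ≤ ll x := by
  rcases Nat.eq_zero_or_pos n with rfl | h
  · simp at hn ⊢; linarith [ll_one hn]
  · have h' : (0:ℝ) < n := by exact_mod_cast h
    unfold ll
    linarith [Real.log_le_log h' (show (n:ℝ) ≤ 1 + x by linarith)]

/-- log sequence -/
noncomputable def lg (n : ℕ) : ℝ := Real.log n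

lemma lg_nonneg (n : ℕ) : 0 ≤ lg n := Real.log_natCast_nonneg n

lemma Glg_le (j : ℕ) {x : ℝ} (hx : 1 ≤ x) : G lg j x ≤ 2 * x ^ (j + 1) * ll x := by
  have hx0 : 0 ≤ x := by linarith
  have : G lg j x ≤ ∑ n ∈ Finset.range (⌊x⌋₊ + 1), ll x * x ^ j := by
    refine Finset.sum_le_sum fun n hn => ?_
    have h1 : n ≤ ⌊x⌋₊ := by simpa [Nat.lt_succ_iff] using hn
    have h2 := (Nat.le_floor_iff hx0).mp h1
    have h3 : (0:ℝ) ≤ n := by positivity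
    have h4 := log_le_ll h2
    have h5 := lg_nonneg n
    have h6 := ll_one hx0
    unfold lg
    gcongr
    · linarith
  refine this.trans ?_
  rw [Finset.sum_const, Finset.card_range, nsmul_eq_mul]
  have h1 : ((⌊x⌋₊ + 1 : ℕ) : ℝ) ≤ 2 * x := by push_cast; linarith [Nat.floor_le hx0]
  have h6 := ll_one hx0
  calc _ ≤ 2 * x * (ll x * x ^ j) := by gcongr
    _ = _ := by ring

lemma Glg_diff (j : ℕ) {x y : ℝ} (hy : 0 ≤ y) (hyx : y ≤ x) (hx : 1 ≤ x) :
    G lg j x - G lg j y ≤ 2 * (j + 1) * x ^ j * (x - y + 1) * ll x := by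
  have hx0 : 0 ≤ x := by linarith
  have h6 := ll_one hx0
  cases j with
  | zero =>
    have hf : ⌊y⌋₊ + 1 ≤ ⌊x⌋₊ + 1 := Nat.add_le_add_right (Nat.floor_mono hyx) 1
    have : G lg 0 x - G lg 0 y = ∑ n ∈ Finset.Ico (⌊y⌋₊ + 1) (⌊x⌋₊ + 1), lg n := by
      rw [Finset.sum_Ico_eq_sub _ hf]; simp [G]
    rw [this]
    have : ∑ n ∈ Finset.Ico (⌊y⌋₊ + 1) (⌊x⌋₊ + 1), lg n ≤ ∑ n ∈ Finset.Ico (⌊y⌋₊ + 1) (⌊x⌋₊ + 1), ll x := by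
      refine Finset.sum_le_sum fun n hn => log_le_ll ?_
      rw [Finset.mem_Ico] at hn
      exact (Nat.le_floor_iff hx0).mp (by omega)
    refine this.trans ?_
    rw [Finset.sum_const, Nat.card_Ico, nsmul_eq_mul, Nat.cast_sub hf]
    have a1 := Nat.floor_le hx0
    have a2 := Nat.lt_floor_add_one y
    push_cast
    simp only [zero_add, pow_zero, mul_one]
    refine mul_le_mul_of_nonneg_right ?_ (by linarith)
    linarith
  | succ j =>
    refine (G_diff lg_nonneg j hy hyx).2.trans ?_
    have a := Glg_le j hx
    have a0 : 0 ≤ x - y := by linarith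
    calc (j + 1) * (x - y) * G lg j x ≤ (j + 1) * (x - y) * (2 * x ^ (j + 1) * ll x) := by gcongr
      _ = 2 * (j + 1) * x ^ (j + 1) * (x - y) * ll x := by ring
      _ ≤ _ := by
        push_cast
        gcongr <;> linarith

lemma G_sub (b c : ℕ → ℝ) (j : ℕ) (x : ℝ) : G (fun n => b n - c n) j x = G b j x - G c j x := by
  simp only [G, sub_mul, Finset.sum_sub_distrib]

lemma G_add (b c : ℕ → ℝ) (j : ℕ) (x : ℝ) : G (fun n => b n + c n) j x = G b j x + G c j x := by
  simp only [G, add_mul, Finset.sum_add_distrib]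

lemma G_small {b : ℕ → ℝ} (hb : b 0 = 0) (j : ℕ) {x : ℝ} (hx : x < 1) : G b j x = 0 := by
  rw [G, Nat.floor_eq_zero.mpr hx]; simp [hb]

lemma desmooth {b : ℕ → ℝ} (hb : ∀ n, 0 ≤ b n) (hb0 : b 0 = 0) {δ : ℝ} (hδ : 0 < δ) (hδ1 : δ ≤ 1) (j : ℕ)
    (h : ∃ C, ∀ x : ℝ, 0 ≤ x → |G (fun n => b n - lg n) (j + 1) x| ≤ C * x ^ (j + 2) * ll x ^ (1 - δ)) :
    ∃ C, ∀ x : ℝ, 0 ≤ x → |G (fun n => b n - lg n) j x| ≤ C * x ^ (j + 1) * ll x ^ (1 - δ / 2) := by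
  obtain ⟨C, h⟩ := h
  have hC : 0 ≤ C := by
    have := (abs_nonneg _).trans (h 1 (by norm_num))
    have h2 : 0 < ll 1 ^ (1 - δ) := Real.rpow_pos_of_pos (by linarith [ll_one zero_le_one]) _
    rw [one_pow, mul_one] at this
    exact nonneg_of_mul_nonneg_left this h2
  refine ⟨12 * (j + 1) * 2 ^ j + C * 2 ^ (j + 3) + C, fun x hx0 => ?_⟩
  rcases lt_or_ge x 1 with hx1 | hx1
  · rw [G_small (by simp [hb0, lg]) j hx1, abs_zero]
    have := ll_one hx0
    positivity
  set l := ll x with hl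
  have hl1 : 1 ≤ l := ll_one hx0
  have hl0 : 0 < l := by linarith
  set hh := l ^ (-(δ / 2)) with hhh
  have hh0 : 0 < hh := Real.rpow_pos_of_pos hl0 _
  have hh1 : hh ≤ 1 := Real.rpow_le_one_of_one_le_of_nonpos hl1 (by linarith)
  set E := l ^ (1 - δ / 2) with hE
  have hE1 : 1 ≤ E := Real.one_le_rpow hl1 (by linarith)
  have e1 : hh * l = E := by
    rw [hhh, hE, ← Real.rpow_add_one hl0.ne']; congr 1; ring
  have e2 : l ^ (1 - δ) = hh * E := by
    rw [hhh, hE, ← Real.rpow_add hl0]; congr 1; ring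
  have hlx : l ≤ 2 * x := (ll_le hx0).trans (by linarith)
  have hxE : x ≤ x * E := le_mul_of_one_le_right hx0 hE1
  have hj : (0:ℝ) ≤ j := by positivity
  have hhx : 0 < hh * x := by positivity
  have hxj : 0 < x ^ j := by positivity
  have bx := abs_le.mp (h x hx0)
  rw [← hl, e2] at bx
  rw [abs_le]
  have hden : 0 < (j + 1) * (hh * x) := by positivity
  have e3 : C * x ^ (j + 2) * (hh * E) ≤ (j + 1) * (hh * x) * (C * x ^ (j + 1) * E) := by
    have : (j + 1) * (hh * x) * (C * x ^ (j + 1) * E) = (j + 1) * (C * x ^ (j + 2) * (hh * E)) := by ring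
    rw [this]
    exact le_mul_of_one_le_left (by positivity) (by linarith)
  have hCE : 0 ≤ C * x ^ (j + 1) * E := by positivity
  have hjE : 0 ≤ (j + 1) * 2 ^ j * x ^ (j + 1) * E := by positivity
  constructor
  · -- lower bound
    have hy0 : 0 ≤ x - hh * x := by nlinarith
    have hyx : x - hh * x ≤ x := by linarith
    have d1 := (G_diff hb j hy0 hyx).2
    have d2 := (G_diff lg_nonneg j hy0 hyx).1
    have d3 := Glg_diff j hy0 hyx hx1
    have by_ := abs_le.mp (h _ hy0)
    have by2 : C * (x - hh * x) ^ (j + 2) * ll (x - hh * x) ^ (1 - δ) ≤ C * x ^ (j + 2) * (hh * E) := by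
      rw [← e2]
      have := ll_one hy0
      have := ll_mono hy0 hyx
      gcongr
    rw [G_sub] at bx by_ ⊢
    have e4 : x - (x - hh * x) = hh * x := by ring
    rw [e4] at d1 d2 d3
    have d3' : G lg j x - G lg j (x - hh * x) ≤ 6 * ((j + 1) * 2 ^ j * x ^ (j + 1) * E) := by
      refine d3.trans ?_
      have : (hh * x + 1) * l ≤ 3 * (x * E) := by
        have : (hh * x + 1) * l = x * (hh * l) + l := by ring
        rw [this, e1]; linarith
      calc _ = 2 * (j + 1) * x ^ j * ((hh * x + 1) * l) := by ring
        _ ≤ 2 * (j + 1) * x ^ j * (3 * (x * E)) := by gcongr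
        _ = 6 * (j + 1) * x ^ (j+1) * E * 1 := by ring
        _ ≤ 6 * (j + 1) * x ^ (j+1) * E * 2 ^ j := by gcongr; exact one_le_pow₀ (by norm_num)
        _ = _ := by ring
    have key : (j + 1) * (hh * x) * (G lg j (x - hh * x) - G b j x) ≤ (j + 1) * (hh * x) * (2 * (C * x ^ (j + 1) * E)) := by
      linarith
    have key2 := le_of_mul_le_mul_left key hden
    have t1 : (8:ℝ) ≤ 2 ^ (j + 3) := by
      have : (1:ℝ) ≤ 2 ^ j := one_le_pow₀ (by norm_num)
      rw [pow_add]; linarith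
    have t2 : C * x ^ (j + 1) * E * 8 ≤ C * x ^ (j + 1) * E * 2 ^ (j + 3) := by gcongr
    have e5 : (12 * (j + 1) * 2 ^ j + C * 2 ^ (j + 3) + C) * x ^ (j + 1) * E =
      12 * ((j + 1) * 2 ^ j * x ^ (j + 1) * E) + C * x ^ (j + 1) * E * 2 ^ (j + 3) + C * x ^ (j + 1) * E := by ring
    rw [e5]
    linarith
  · have hyx : x ≤ x + hh * x := by linarith
    have hy2 : x + hh * x ≤ 2 * x := by nlinarith
    have hy0 : 0 ≤ x + hh * x := by linarith
    have d1 := (G_diff hb j hx0 hyx).1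
    have d2 := (G_diff lg_nonneg j hx0 hyx).2
    have d3 := Glg_diff j hx0 hyx (by linarith)
    have by_ := abs_le.mp (h _ hy0)
    have hll : ll (x + hh * x) ≤ 2 * l := (ll_mono hy0 hy2).trans (ll_two hx0)
    have hll1 := ll_one hy0
    have by2 : C * (x + hh * x) ^ (j + 2) * ll (x + hh * x) ^ (1 - δ) ≤ 2 ^ (j + 3) * (C * x ^ (j + 2) * (hh * E)) := by
      rw [← e2]
      calc _ ≤ C * (2 * x) ^ (j + 2) * (2 * l) ^ (1 - δ) := by gcongr
        _ = C * (2 * x) ^ (j + 2) * (2 ^ (1 - δ) * l ^ (1 - δ)) := by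
            rw [Real.mul_rpow (by norm_num) hl0.le]
        _ ≤ C * (2 * x) ^ (j + 2) * (2 ^ (1:ℝ) * l ^ (1 - δ)) := by
            gcongr
            · norm_num
            · linarith
        _ = _ := by rw [Real.rpow_one, mul_pow]; ring
    rw [G_sub] at bx by_ ⊢
    have e4 : (x + hh * x) - x = hh * x := by ring
    rw [e4] at d1 d2 d3
    have d3' : G lg j (x + hh * x) - G lg j x ≤ 12 * ((j + 1) * 2 ^ j * x ^ (j + 1) * E) := by
      refine d3.trans ?_
      have : (hh * x + 1) * l ≤ 3 * (x * E) := by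
        have : (hh * x + 1) * l = x * (hh * l) + l := by ring
        rw [this, e1]; linarith
      calc _ ≤ 2 * (j + 1) * (2 * x) ^ j * (hh * x + 1) * (2 * l) := by gcongr
        _ = 2 * (j + 1) * (2 * x) ^ j * 2 * ((hh * x + 1) * l) := by ring
        _ ≤ 2 * (j + 1) * (2 * x) ^ j * 2 * (3 * (x * E)) := by gcongr
        _ = _ := by rw [mul_pow]; ring
    have e6 := mul_le_mul_of_nonneg_left e3 (show (0:ℝ) ≤ 2 ^ (j + 3) by positivity)
    have key : (j + 1) * (hh * x) * (G b j x - G lg j (x + hh * x)) ≤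
        (j + 1) * (hh * x) * (C * x ^ (j + 1) * E * 2 ^ (j + 3) + C * x ^ (j + 1) * E) := by
      linarith
    have key2 := le_of_mul_le_mul_left key hden
    have e5 : (12 * (j + 1) * 2 ^ j + C * 2 ^ (j + 3) + C) * x ^ (j + 1) * E =
      12 * ((j + 1) * 2 ^ j * x ^ (j + 1) * E) + C * x ^ (j + 1) * E * 2 ^ (j + 3) + C * x ^ (j + 1) * E := by ring
    rw [e5]
    linarith

lemma desmooth_all {b : ℕ → ℝ} (hb : ∀ n, 0 ≤ b n) (hb0 : b 0 = 0) (k : ℕ) : ∀ {δ : ℝ} (_ : 0 < δ) (_ : δ ≤ 1)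
    (_ : ∃ C, ∀ x : ℝ, 0 ≤ x → |G (fun n => b n - lg n) k x| ≤ C * x ^ (k + 1) * ll x ^ (1 - δ)),
    ∃ δ' : ℝ, 0 < δ' ∧ δ' ≤ 1 ∧ ∃ C, ∀ x : ℝ, 0 ≤ x → |G (fun n => b n - lg n) 0 x| ≤ C * x * ll x ^ (1 - δ') := by
  induction k with
  | zero => 
    rintro δ h0 h1 ⟨C, h⟩
    exact ⟨δ, h0, h1, C, fun x hx => by simpa using h x hx⟩
  | succ k ih =>
    intro δ h0 h1 h
    exact ih (by linarith) (by linarith) (desmooth hb hb0 h0 h1 k h)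

end DGK

namespace DGK
open Complex MeasureTheory Set Topology

lemma tsum_ff (e : ℕ → ℝ) {k : ℕ} (hk : k ≠ 0) {X : ℝ} (hX : 0 < X) :
    ∑' n : ℕ, (e n : ℂ) * ff k (n / X) = ((G e k X / X ^ k : ℝ) : ℂ) := by
  rw [tsum_eq_sum (s := Finset.range (⌊X⌋₊ + 1))]
  · rw [G, Finset.sum_div]
    push_cast
    refine Finset.sum_congr rfl fun n hn => ?_
    have h1 : n ≤ ⌊X⌋₊ := by simpa [Nat.lt_succ_iff] using hn
    have h2 := (Nat.le_floor_iff hX.le).mp h1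
    have : max (1 - n / X) 0 = (X - n) / X := by
      rw [max_eq_left]
      · field_simp
      · rw [sub_nonneg, div_le_one hX]; exact h2
    rw [ff, this]
    push_cast
    rw [div_pow, mul_div_assoc]
  · intro n hn
    have h1 : ⌊X⌋₊ < n := by simpa [Nat.lt_succ_iff] using hn
    have h2 := (Nat.floor_lt hX.le).mp h1
    rw [ff_zero hk, mul_zero]
    rw [one_le_div hX]; exact h2.le

lemma G_bound {e : ℕ → ℝ} (he0 : e 0 = 0) (hb : ∀ σ : ℝ, 1 < σ → LSeriesSummable (fun n => (e n : ℂ)) σ)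
    (hPG : PG {s | 1 < s.re ∧ s.re ≤ 2} (LSeries (fun n => (e n : ℂ)))) :
    ∃ A : ℕ, ∀ k : ℕ, A ≤ k → ∃ C : ℝ, ∀ X : ℝ, 0 ≤ X → |G e k X| ≤ C * X ^ (k + 1) := by
  obtain ⟨A, h⟩ := smooth_bound (b := fun n => (e n : ℂ)) (by simp [he0]) hb hPG
  refine ⟨A, fun k hk => ?_⟩
  obtain ⟨hk0, C, hC⟩ := h k hk
  set D := ∑ n ∈ Finset.range 4, |e n| * 3 ^ k with hD
  have hD0 : 0 ≤ D := Finset.sum_nonneg fun n _ => by positivity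
  refine ⟨|C| + D, fun X hX => ?_⟩
  rcases lt_or_ge X 1 with h1 | h1
  · rw [G_small he0 k h1, abs_zero]; positivity
  have hXp : 0 < X := by linarith
  have hX1 : 1 ≤ X ^ (k + 1) := one_le_pow₀ h1
  rcases lt_or_ge X 3 with h3 | h3
  · have : |G e k X| ≤ D := by
      rw [G]
      refine (Finset.abs_sum_le_sum_abs _ _).trans ?_
      have hfl : ⌊X⌋₊ < 3 := (Nat.floor_lt hX).mpr (by exact_mod_cast h3)
      refine le_trans ?_ (Finset.sum_le_sum_of_subset_of_nonneg (s := Finset.range (⌊X⌋₊ + 1))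
        (Finset.range_mono (by omega)) fun n _ _ => by positivity)
      refine Finset.sum_le_sum fun n hn => ?_
      have h1 : n ≤ ⌊X⌋₊ := by simpa [Nat.lt_succ_iff] using hn
      have h2 := (Nat.le_floor_iff hXp.le).mp h1
      have h4 : (0:ℝ) ≤ n := by positivity
      rw [abs_mul, abs_pow, abs_of_nonneg (by linarith : (0:ℝ) ≤ X - n)]
      gcongr
      linarith
    have h5 : 0 ≤ |C| := abs_nonneg C
    nlinarith
  · have := hC X h3
    rw [tsum_ff e hk0 hXp, Complex.norm_real, Real.norm_eq_abs, abs_div, abs_of_pos (by positivity : 0 < X ^ k),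
      div_le_iff₀ (by positivity)] at this
    refine this.trans ?_
    have h5 : C ≤ |C| + D := (le_abs_self C).trans (by linarith)
    calc C * X * X ^ k = C * X ^ (k + 1) := by ring
      _ ≤ _ := by gcongr

/-- real part of a character -/
noncomputable def cr {d : ℕ} (χ : DirichletCharacter ℂ d) (n : ℕ) : ℝ := (χ (n : ZMod d)).re

lemma cr_cases {d : ℕ} {χ : DirichletCharacter ℂ d} (hq : MulChar.IsQuadratic χ) (n : ℕ) :
    cr χ n = 0 ∨ cr χ n = 1 ∨ cr χ n = -1 := by
  unfold cr
  rcases hq n with h | h | h <;> simp [h]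

lemma cr_eq {d : ℕ} {χ : DirichletCharacter ℂ d} (hq : MulChar.IsQuadratic χ) (n : ℕ) :
    χ (n : ZMod d) = ((cr χ n : ℝ) : ℂ) := by
  unfold cr
  rcases hq n with h | h | h <;> simp [h]

lemma cr_abs {d : ℕ} {χ : DirichletCharacter ℂ d} (hq : MulChar.IsQuadratic χ) (n : ℕ) : |cr χ n| ≤ 1 := by
  rcases cr_cases hq n with h | h | h <;> simp [h]

open ArithmeticFunction in
lemma main_zeta : ∃ A : ℕ, ∀ k : ℕ, A ≤ k → ∃ C : ℝ, ∀ X : ℝ, 0 ≤ X →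
    |G (fun n => vonMangoldt n * lg n - lg n) k X| ≤ C * X ^ (k + 1) := by
  have e : (fun n : ℕ => ((vonMangoldt n * lg n - lg n : ℝ) : ℂ)) =
      LSeries.logMul (fun n => ((vonMangoldt n : ℝ) : ℂ) - 1) := by
    ext n
    simp only [LSeries.logMul, lg]
    push_cast
    ring
  refine G_bound (by simp [lg]) ?_ ?_
  · intro σ hσ
    rw [e]
    refine LSeriesSummable_of_abscissaOfAbsConv_lt_re ?_
    rw [LSeries.abscissaOfAbsConv_logMul]
    refine lt_of_le_of_lt (LSeries.abscissaOfAbsConv_le_of_forall_lt_LSeriesSummable (x := 1) fun y hy => ?_) (by rw [ofReal_re]; exact_mod_cast hσ)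
    refine LSeriesSummable.sub (LSeriesSummable_vonMangoldt (by simpa using hy)) ?_
    exact LSeriesSummable_one_iff.mpr (by simpa using hy)
  · rw [e]; exact zeta_PG

open ArithmeticFunction in
lemma main_chi {d : ℕ} [NeZero d] {χ : DirichletCharacter ℂ d} (hq : MulChar.IsQuadratic χ) (hne : χ ≠ 1) :
    ∃ A : ℕ, ∀ k : ℕ, A ≤ k → ∃ C : ℝ, ∀ X : ℝ, 0 ≤ X →
    |G (fun n => cr χ n * vonMangoldt n * lg n) k X| ≤ C * X ^ (k + 1) := by
  have e : (fun n : ℕ => ((cr χ n * vonMangoldt n * lg n : ℝ) : ℂ)) =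
      LSeries.logMul (fun n => χ n * ((vonMangoldt n : ℝ) : ℂ)) := by
    ext n
    simp only [LSeries.logMul, lg, cr_eq hq]
    push_cast
    ring
  refine G_bound (by simp [lg]) ?_ ?_
  · intro σ hσ
    rw [e]
    refine LSeriesSummable_of_abscissaOfAbsConv_lt_re ?_
    rw [LSeries.abscissaOfAbsConv_logMul]
    refine lt_of_le_of_lt (LSeries.abscissaOfAbsConv_le_of_forall_lt_LSeriesSummable (x := 1) fun y hy => ?_) (by rw [ofReal_re]; exact_mod_cast hσ)
    exact DirichletCharacter.LSeriesSummable_twist_vonMangoldt χ (s := y) (by simpa using hy)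
  · rw [e]; exact chi_PG hne hq.sq_eq_one

lemma rpow_ll_mono {C x a b : ℝ} (hx : 0 ≤ x) (hab : a ≤ b) : C * x * ll x ^ a ≤ |C| * x * ll x ^ b := by
  have h1 := ll_one hx
  have h2 : ll x ^ a ≤ ll x ^ b := Real.rpow_le_rpow_of_exponent_le h1 hab
  have h3 := le_abs_self C
  have : 0 ≤ ll x ^ a := by positivity
  gcongr

open ArithmeticFunction in
lemma main_sums {d : ℕ} [NeZero d] {χ : DirichletCharacter ℂ d} (hq : MulChar.IsQuadratic χ) (hne : χ ≠ 1) :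
    ∃ δ : ℝ, 0 < δ ∧ δ ≤ 1 ∧ ∃ C : ℝ, 0 ≤ C ∧ ∀ N : ℕ,
      |∑ n ∈ Finset.range (N + 1), (vonMangoldt n * lg n - lg n)| ≤ C * N * ll N ^ (1 - δ) ∧
      |∑ n ∈ Finset.range (N + 1), cr χ n * vonMangoldt n * lg n| ≤ C * N * ll N ^ (1 - δ) := by
  obtain ⟨A, hA⟩ := main_zeta
  obtain ⟨B, hB⟩ := main_chi hq hne
  obtain ⟨C1, h1⟩ := hA (max A B) (le_max_left _ _)
  obtain ⟨C2, h2⟩ := hB (max A B) (le_max_right _ _)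
  set k := max A B
  have p1 := desmooth_all (b := fun n => vonMangoldt n * lg n) (fun n => mul_nonneg vonMangoldt_nonneg (lg_nonneg n))
    (by simp) k zero_lt_one le_rfl ⟨C1, fun x hx => by simpa using h1 x hx⟩
  have p2 := desmooth_all (b := fun n => vonMangoldt n * lg n + cr χ n * vonMangoldt n * lg n) (fun n => by
      have := (abs_le.mp (cr_abs hq n)).1
      have e : vonMangoldt n * lg n + cr χ n * vonMangoldt n * lg n = (1 + cr χ n) * (vonMangoldt n * lg n) := by ring
      rw [e]
      exact mul_nonneg (by linarith) (mul_nonneg vonMangoldt_nonneg (lg_nonneg n)))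
    (by simp) k zero_lt_one le_rfl ⟨C1 + C2, fun x hx => by
      have e : (fun n : ℕ => vonMangoldt n * lg n + cr χ n * vonMangoldt n * lg n - lg n) =
        fun n : ℕ => (vonMangoldt n * lg n - lg n) + cr χ n * vonMangoldt n * lg n := by ext n; ring
      rw [e, G_add (fun n : ℕ => vonMangoldt n * lg n - lg n)]
      have := (abs_add_le _ _).trans (add_le_add (h1 x hx) (h2 x hx))
      refine this.trans (le_of_eq ?_)
      rw [sub_self, Real.rpow_zero]; ring⟩
  obtain ⟨δ1, a1, a2, D1, a3⟩ := p1
  obtain ⟨δ2, b1, b2, D2, b3⟩ := p2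
  refine ⟨min δ1 δ2, lt_min a1 b1, (min_le_left _ _).trans a2, |D1| + (|D1| + |D2|), by positivity, fun N => ?_⟩
  have hN : (0:ℝ) ≤ N := by positivity
  have A3 := (a3 N hN).trans (rpow_ll_mono hN (show 1 - δ1 ≤ 1 - min δ1 δ2 by linarith [min_le_left δ1 δ2]))
  have B3 := (b3 N hN).trans (rpow_ll_mono hN (show 1 - δ2 ≤ 1 - min δ1 δ2 by linarith [min_le_right δ1 δ2]))
  set E := ll N ^ (1 - min δ1 δ2)
  have hE : 0 ≤ E := Real.rpow_nonneg (by linarith [ll_one hN]) _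
  have g0 : ∀ e : ℕ → ℝ, G e 0 N = ∑ n ∈ Finset.range (N + 1), e n := by
    intro e; simp [G]
  rw [g0] at A3 B3
  have n1 : 0 ≤ |D1| * N * E := by positivity
  have n2 : 0 ≤ |D2| * N * E := by positivity
  constructor
  · linarith
  · have e : ∑ n ∈ Finset.range (N + 1), cr χ n * vonMangoldt n * lg n =
      ∑ n ∈ Finset.range (N + 1), (vonMangoldt n * lg n + cr χ n * vonMangoldt n * lg n - lg n) -
      ∑ n ∈ Finset.range (N + 1), (vonMangoldt n * lg n - lg n) := by
      rw [← Finset.sum_sub_distrib]; refine Finset.sum_congr rfl fun n _ => by ring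
    rw [e]
    have := (abs_sub _ _).trans (add_le_add B3 A3)
    linarith

end DGK

namespace DGK
open Complex MeasureTheory Set Topology

/-- prime indicator -/
noncomputable def pr (n : ℕ) : ℝ := by classical exact if n.Prime then 1 else 0

lemma pr_of {n : ℕ} (h : n.Prime) : pr n = 1 := by simp [pr, h]
lemma pr_not {n : ℕ} (h : ¬ n.Prime) : pr n = 0 := by simp [pr, h]
lemma pr_nonneg (n : ℕ) : 0 ≤ pr n := by unfold pr; split_ifs <;> norm_num
lemma pr_le (n : ℕ) : pr n ≤ 1 := by unfold pr; split_ifs <;> norm_num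

lemma ll_rpow_le (α : ℝ) (hα : 0 ≤ α) : ∃ C : ℝ, 0 ≤ C ∧ ∀ x : ℝ, 1 ≤ x → ll x ^ α ≤ C * x ^ (1 / 2 : ℝ) := by
  set ε : ℝ := 1 / (2 * (α + 1)) with hε
  have hε0 : 0 < ε := by positivity
  refine ⟨(1 + 1 / ε) ^ α * 2 ^ (1 / 2 : ℝ), by positivity, fun x hx => ?_⟩
  have h1 : ll x ≤ (1 + 1 / ε) * (2 * x) ^ ε := by
    have a := Real.log_le_rpow_div (show 0 ≤ 1 + x by linarith) hε0
    have b : (1 + x) ^ ε ≤ (2 * x) ^ ε := by gcongr; linarith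
    have c : 1 ≤ (2 * x) ^ ε := Real.one_le_rpow (by linarith) hε0.le
    unfold ll
    have : (1 + x) ^ ε / ε ≤ (2 * x) ^ ε / ε := by gcongr
    have e : (1 + 1 / ε) * (2 * x) ^ ε = (2 * x) ^ ε + (2 * x) ^ ε / ε := by ring
    rw [e]; linarith
  have h0 := ll_one (show 0 ≤ x by linarith)
  calc ll x ^ α ≤ ((1 + 1 / ε) * (2 * x) ^ ε) ^ α := by gcongr
    _ = (1 + 1 / ε) ^ α * (2 * x) ^ (ε * α) := by
        rw [Real.mul_rpow (by positivity) (by positivity), ← Real.rpow_mul (by positivity)]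
    _ ≤ (1 + 1 / ε) ^ α * (2 * x) ^ (1 / 2 : ℝ) := by
        gcongr
        · linarith
        · rw [hε, div_mul_eq_mul_div, one_mul, div_le_div_iff₀ (by positivity) (by norm_num)]
          linarith
    _ = _ := by rw [Real.mul_rpow (by norm_num) (by linarith)]; ring

/-- consequence: `√x ≤ C x ll^{-α}` -/
lemma sqrt_le_ll (α : ℝ) (hα : 0 ≤ α) : ∃ C : ℝ, 0 ≤ C ∧ ∀ x : ℝ, 1 ≤ x → x ^ (1 / 2 : ℝ) ≤ C * x * ll x ^ (-α) := by
  obtain ⟨C, hC, h⟩ := ll_rpow_le α hα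
  refine ⟨C, hC, fun x hx => ?_⟩
  have h0 := ll_one (show 0 ≤ x by linarith)
  have hp : 0 < ll x ^ α := by positivity
  rw [Real.rpow_neg (by linarith), ← div_eq_mul_inv, le_div_iff₀ hp]
  have e : x = x ^ (1 / 2 : ℝ) * x ^ (1 / 2 : ℝ) := by
    rw [← Real.rpow_add (by linarith)]; norm_num
  calc x ^ (1 / 2 : ℝ) * ll x ^ α ≤ x ^ (1 / 2 : ℝ) * (C * x ^ (1 / 2 : ℝ)) := by gcongr; exact h x hx
    _ = C * (x ^ (1 / 2 : ℝ) * x ^ (1 / 2 : ℝ)) := by ring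
    _ = _ := by rw [← e]

lemma log_le_sqrt4 {x : ℝ} (hx : 1 ≤ x) : Real.log x ^ 2 ≤ 16 * x ^ (1 / 2 : ℝ) := by
  have a := Real.log_le_rpow_div (show 0 ≤ x by linarith) (show (0:ℝ) < 1 / 4 by norm_num)
  have b := Real.log_nonneg hx
  have e : (x ^ (1/4 : ℝ)) ^ 2 = x ^ (1/2 : ℝ) := by
    rw [← Real.rpow_natCast, ← Real.rpow_mul (by linarith)]; norm_num
  rw [← e]
  have c : Real.log x ≤ 4 * x ^ (1/4:ℝ) := by rw [div_div_eq_mul_div] at a; linarith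
  nlinarith

open ArithmeticFunction in
lemma drop_powers (c : ℕ → ℝ) (hc : ∀ n, |c n| ≤ 1) (N : ℕ) :
    |∑ n ∈ Finset.range (N + 1), c n * vonMangoldt n * lg n - ∑ n ∈ Finset.range (N + 1), c n * (pr n * lg n ^ 2)|
      ≤ 32 * N := by
  rcases Nat.eq_zero_or_pos N with rfl | hN
  · simp [lg]
  have hN1 : (1:ℝ) ≤ N := by exact_mod_cast hN
  have h0 := Chebyshev.psi_sub_theta_le hN1
  rw [Chebyshev.psi_sub_theta_eq_sum_not_prime, Nat.floor_natCast] at h0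
  have hlog : 0 ≤ Real.log N := Real.log_nonneg hN1
  rw [← Finset.sum_sub_distrib]
  refine (Finset.abs_sum_le_sum_abs _ _).trans ?_
  have s1 : ∑ n ∈ Finset.range (N + 1), |c n * vonMangoldt n * lg n - c n * (pr n * lg n ^ 2)| ≤
      ∑ n ∈ Finset.range (N + 1), (if ¬ n.Prime then vonMangoldt n else 0) * Real.log N := by
    refine Finset.sum_le_sum fun n hn => ?_
    by_cases hp : n.Prime
    · rw [pr_of hp, vonMangoldt_apply_prime hp]
      simp only [hp, not_true, if_false, zero_mul, lg]
      apply le_of_eq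
      rw [abs_eq_zero]; ring
    · rw [pr_not hp, if_pos hp]
      simp only [zero_mul, mul_zero, sub_zero, abs_mul]
      rw [abs_of_nonneg vonMangoldt_nonneg, abs_of_nonneg (lg_nonneg n)]
      have v : 0 ≤ vonMangoldt n := vonMangoldt_nonneg
      have : lg n ≤ Real.log N := by
        rcases Nat.eq_zero_or_pos n with rfl | h
        · simpa [lg] using hlog
        · exact Real.log_le_log (by exact_mod_cast h) (by exact_mod_cast Nat.lt_succ_iff.mp (Finset.mem_range.mp hn))
      have l0 := lg_nonneg n
      calc |c n| * vonMangoldt n * lg n ≤ 1 * vonMangoldt n * Real.log N := by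
            gcongr; exact hc n
        _ = _ := by ring
  refine s1.trans ?_
  rw [← Finset.sum_mul]
  have s2 : ∑ n ∈ Finset.range (N + 1), (if ¬ n.Prime then vonMangoldt n else 0) =
      ∑ n ∈ Finset.Ioc 0 N with ¬ n.Prime, vonMangoldt n := by
    rw [Finset.sum_filter]
    symm
    refine Finset.sum_subset (fun n hn => by simp at hn ⊢; omega) fun n hn hn' => ?_
    have : n = 0 := by simp at hn hn'; omega
    subst this; simp
  rw [s2]
  have s3 := log_le_sqrt4 hN1
  calc _ ≤ 2 * √(N:ℝ) * Real.log N * Real.log N := by gcongr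
    _ = 2 * √(N:ℝ) * (Real.log N ^ 2) := by ring
    _ ≤ 2 * √(N:ℝ) * (16 * (N:ℝ) ^ (1 / 2 : ℝ)) := by gcongr
    _ = 32 * (√(N:ℝ) * √(N:ℝ)) := by rw [← Real.sqrt_eq_rpow]; ring
    _ = 32 * N := by rw [Real.mul_self_sqrt (by linarith)]

/-- PB: partial sums small. -/
def PB (δ : ℝ) (e : ℕ → ℝ) : Prop :=
  ∃ C : ℝ, 0 ≤ C ∧ ∀ N : ℕ, |∑ n ∈ Finset.range (N + 1), e n| ≤ C * N * ll N ^ (-(1 + δ))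

lemma sum_ll_le (α : ℝ) (hα : 0 ≤ α) : ∃ C : ℝ, 0 ≤ C ∧ ∀ N : ℕ, 1 ≤ N →
    ∑ n ∈ Finset.range (N + 1), ll n ^ (-α) ≤ C * N * ll N ^ (-α) := by
  obtain ⟨C, hC, h⟩ := sqrt_le_ll α hα
  refine ⟨2 * C + 2 * 2 ^ α, by positivity, fun N hN => ?_⟩
  have hN1 : (1:ℝ) ≤ N := by exact_mod_cast hN
  have hN0 := ll_one (show (0:ℝ) ≤ N by linarith)
  have hN' := h N hN1
  set s := (N:ℝ) ^ (1/2:ℝ) with hs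
  have hs1 : 1 ≤ s := Real.one_le_rpow hN1 (by norm_num)
  have hss : s * s = N := by rw [hs, ← Real.rpow_add (by linarith)]; norm_num
  have t : ∀ n ∈ Finset.range (N + 1), ll n ^ (-α) ≤ (if (n:ℝ) ≤ s then 1 else 0) + 2 ^ α * ll N ^ (-α) := by
    intro n hn
    have hn0 := ll_one (show (0:ℝ) ≤ n by positivity)
    split_ifs with hc
    · have : ll n ^ (-α) ≤ 1 := Real.rpow_le_one_of_one_le_of_nonpos hn0 (by linarith)
      have : 0 ≤ 2 ^ α * ll N ^ (-α) := by positivity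
      linarith
    · push Not at hc
      have : ll N ≤ 2 * ll n := by
        unfold ll
        have h1 : Real.log (1 + N) ≤ Real.log ((1 + n) ^ 2) := Real.log_le_log (by linarith) (by nlinarith)
        rw [Real.log_pow] at h1
        push_cast at h1
        linarith
      have h2 : ll N / 2 ≤ ll n := by linarith
      have h3 := Real.rpow_le_rpow_of_nonpos (by linarith : 0 < ll N / 2) h2 (by linarith : -α ≤ 0)
      rw [Real.div_rpow (by linarith) (by norm_num), Real.rpow_neg (by norm_num : (0:ℝ) ≤ 2), div_inv_eq_mul] at h3
      linarith
  refine (Finset.sum_le_sum t).trans ?_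
  rw [Finset.sum_add_distrib, Finset.sum_const, Finset.card_range, nsmul_eq_mul, ← Finset.sum_filter,
    Finset.sum_const, nsmul_eq_mul, mul_one]
  have c1 : (((Finset.range (N + 1)).filter (fun n : ℕ => (n:ℝ) ≤ s)).card : ℝ) ≤ 2 * s := by
    have : ((Finset.range (N + 1)).filter (fun n : ℕ => (n:ℝ) ≤ s)) ⊆ Finset.range (⌊s⌋₊ + 1) := by
      intro n hn
      simp only [Finset.mem_filter, Finset.mem_range] at hn ⊢
      have := Nat.le_floor hn.2
      omega
    have := Finset.card_le_card this
    rw [Finset.card_range] at this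
    have h2 : (((Finset.range (N + 1)).filter (fun n : ℕ => (n:ℝ) ≤ s)).card : ℝ) ≤ ⌊s⌋₊ + 1 := by exact_mod_cast this
    linarith [Nat.floor_le (show 0 ≤ s by linarith)]
  have c2 : ((N + 1 : ℕ) : ℝ) ≤ 2 * N := by push_cast; linarith
  have : 0 ≤ 2 ^ α * ll N ^ (-α) := by positivity
  calc _ ≤ 2 * s + 2 * N * (2 ^ α * ll N ^ (-α)) := by gcongr
    _ ≤ 2 * (C * N * ll N ^ (-α)) + 2 * N * (2 ^ α * ll N ^ (-α)) := by linarith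
    _ = _ := by ring

lemma abel_id (E w : ℕ → ℝ) {N : ℕ} (hN : 2 ≤ N) :
    ∑ n ∈ Finset.Ico 2 (N + 1), E n * w n = (∑ n ∈ Finset.range (N + 1), E n) * w N -
      (E 0 + E 1) * w 2 + ∑ n ∈ Finset.Ico 2 N, (∑ i ∈ Finset.range (n + 1), E i) * (w n - w (n + 1)) := by
  induction N, hN using Nat.le_induction with
  | base => simp [Finset.sum_range_succ]; ring
  | succ N hN ih =>
    rw [Finset.sum_Ico_succ_top (by omega), ih, Finset.sum_Ico_succ_top hN, Finset.sum_range_succ E (N + 1)]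
    ring

lemma log_two_le {n : ℕ} (hn : 2 ≤ n) : 0.69 ≤ Real.log n := by
  have := Real.log_le_log (by norm_num) (show (2:ℝ) ≤ n by exact_mod_cast hn)
  linarith [Real.log_two_gt_d9]

lemma ll_le_log {x : ℝ} (hx : 2 ≤ x) : ll x ≤ 4 * Real.log x := by
  have h0 := Real.log_le_log (by norm_num) hx
  have h2 := Real.log_two_gt_d9
  have h1 : Real.log (1 + x) ≤ Real.log (x ^ 2) := Real.log_le_log (by linarith) (by nlinarith)
  rw [Real.log_pow] at h1
  push_cast at h1
  unfold ll; linarith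

lemma w_diff {n : ℕ} (hn : 2 ≤ n) : |1 / lg n ^ 2 - 1 / lg (n + 1) ^ 2| ≤ 2 / (n * lg n ^ 3) := by
  have h1 := log_two_le hn
  have h2 : Real.log n ≤ Real.log (n + 1) := Real.log_le_log (by positivity) (by linarith)
  have hn0 : (0:ℝ) < n := by positivity
  have h3 : Real.log (n + 1) - Real.log n ≤ 1 / n := by
    rw [← Real.log_div (by positivity) (by positivity)]
    have := Real.log_le_sub_one_of_pos (show 0 < ((n:ℝ) + 1) / n by positivity)
    refine this.trans (le_of_eq ?_)
    field_simp; ring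
  unfold lg
  push_cast
  set a := Real.log n
  set b := Real.log (n + 1)
  have ha : 0 < a := by linarith
  have hb : 0 < b := by linarith
  have e : 1 / a ^ 2 - 1 / b ^ 2 = (b - a) * (b + a) / (a ^ 2 * b ^ 2) := by field_simp; ring
  rw [e, abs_of_nonneg (div_nonneg (mul_nonneg (by linarith) (by linarith)) (by positivity))]
  calc (b - a) * (b + a) / (a ^ 2 * b ^ 2) ≤ 1 / n * (b + b) / (a ^ 2 * b ^ 2) := by gcongr
    _ = 2 / (n * (a ^ 2 * b)) := by field_simp; ring
    _ ≤ 2 / (n * (a ^ 2 * a)) := by gcongr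
    _ = _ := by ring

lemma abel_log {E : ℕ → ℝ} (h0 : E 0 = 0) (h1 : E 1 = 0) {δ : ℝ} (hδ : 0 < δ) (hδ1 : δ ≤ 1)
    (h : ∃ C : ℝ, 0 ≤ C ∧ ∀ N : ℕ, |∑ n ∈ Finset.range (N + 1), E n| ≤ C * N * ll N ^ (1 - δ)) :
    PB δ (fun n => E n / lg n ^ 2) := by
  obtain ⟨C, hC, h⟩ := h
  obtain ⟨D, hD, hsum⟩ := sum_ll_le (1 + δ) (by linarith)
  refine ⟨16 * C + 128 * C * D, by positivity, fun N => ?_⟩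
  have hll := ll_one (show (0:ℝ) ≤ N by positivity)
  have e0 : ∑ n ∈ Finset.range (N + 1), E n / lg n ^ 2 = ∑ n ∈ Finset.Ico 2 (N + 1), E n * (1 / lg n ^ 2) := by
    simp_rw [mul_one_div]
    symm
    refine Finset.sum_subset (fun n hn => by simp at hn ⊢; omega) fun n hn hn' => ?_
    have : n = 0 ∨ n = 1 := by simp at hn hn'; omega
    rcases this with rfl | rfl <;> simp [h0, h1]
  rw [e0]
  rcases lt_or_ge N 2 with hN | hN
  · rw [Finset.Ico_eq_empty (by omega)]; simp; positivity
  rw [abel_id _ _ hN, h0, h1]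
  have b4 : ∀ n : ℕ, 2 ≤ n → ll n ≤ 4 * lg n := fun n hn => ll_le_log (by exact_mod_cast hn)
  have t1 : |(∑ n ∈ Finset.range (N + 1), E n) * (1 / lg N ^ 2)| ≤ 16 * C * N * ll N ^ (-(1 + δ)) := by
    have a1 := b4 N hN
    have a2 : 0 < lg N := by linarith
    rw [abs_mul, abs_of_pos (by positivity : 0 < 1 / lg N ^ 2)]
    have a3 : 1 / lg N ^ 2 ≤ 16 * ll N ^ (-2 : ℝ) := by
      rw [Real.rpow_neg (by linarith), ← div_eq_mul_inv, div_le_div_iff₀ (by positivity) (by positivity)]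
      norm_cast
      nlinarith
    calc _ ≤ C * N * ll N ^ (1 - δ) * (16 * ll N ^ (-2 : ℝ)) := by gcongr; exact h N
      _ = 16 * C * N * (ll N ^ (1 - δ) * ll N ^ (-2 : ℝ)) := by ring
      _ = _ := by rw [← Real.rpow_add (by linarith)]; congr 2; ring
  have t2 : |∑ n ∈ Finset.Ico 2 N, (∑ i ∈ Finset.range (n + 1), E i) * (1 / lg n ^ 2 - 1 / lg (n + 1) ^ 2)| ≤
      128 * C * (D * N * ll N ^ (-(1 + δ))) := by
    refine (Finset.abs_sum_le_sum_abs _ _).trans ?_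
    have : ∑ n ∈ Finset.Ico 2 N, |(∑ i ∈ Finset.range (n + 1), E i) * (1 / lg n ^ 2 - 1 / lg (n + 1) ^ 2)| ≤
        ∑ n ∈ Finset.Ico 2 N, 128 * C * ll n ^ (-(1 + δ)) := by
      refine Finset.sum_le_sum fun n hn => ?_
      have hn2 := (Finset.mem_Ico.mp hn).1
      have hn0 : (0:ℝ) < n := by positivity
      have l1 := ll_one hn0.le
      have a1 := b4 n hn2
      have a2 : 0 < lg n := by linarith
      rw [abs_mul]
      have a3 : 1 / lg n ^ 3 ≤ 64 * ll n ^ (-3 : ℝ) := by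
        rw [Real.rpow_neg (by linarith), ← div_eq_mul_inv, div_le_div_iff₀ (by positivity) (by positivity)]
        norm_cast
        have := pow_le_pow_left₀ (by linarith) a1 3
        linarith
      have a4 : 2 / (n * lg n ^ 3) ≤ 128 * ll n ^ (-3 : ℝ) / n := by
        have : 2 / (n * lg n ^ 3) = 2 * (1 / lg n ^ 3) / n := by field_simp
        rw [this]; exact div_le_div_of_nonneg_right (by linarith) hn0.le
      calc _ ≤ C * n * ll n ^ (1 - δ) * (128 * ll n ^ (-3 : ℝ) / n) := by
            refine mul_le_mul (h n) ((w_diff hn2).trans a4) (abs_nonneg _) (by positivity)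
        _ = 128 * C * (ll n ^ (1 - δ) * ll n ^ (-3 : ℝ)) := by field_simp
        _ = 128 * C * ll n ^ (-(1 + δ) - 1) := by rw [← Real.rpow_add (by linarith)]; congr 2; ring
        _ ≤ _ := by gcongr; linarith
    refine this.trans ?_
    rw [← Finset.mul_sum]
    gcongr
    refine le_trans ?_ (hsum N (by omega))
    refine Finset.sum_le_sum_of_subset_of_nonneg (fun n hn => by simp at hn ⊢; omega) fun n _ _ => ?_
    have := ll_one (show (0:ℝ) ≤ n by positivity)
    positivity
  rw [add_zero, zero_mul, sub_zero]
  refine (abs_add_le _ _).trans ((add_le_add t1 t2).trans (le_of_eq ?_))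
  ring

end DGK

namespace DGK
open Complex MeasureTheory Set Topology

lemma lg_pos {n : ℕ} (hn : 2 ≤ n) : 0 < lg n := by have := log_two_le hn; unfold lg; linarith

lemma PB_bounded {δ : ℝ} (hδ : 0 < δ) {e e' : ℕ → ℝ} (h : PB δ e) (K : ℝ)
    (hK : ∀ N : ℕ, |∑ n ∈ Finset.range (N + 1), (e' n - e n)| ≤ K) (h0 : e' 0 = 0) : PB δ e' := by
  obtain ⟨C, hC, h⟩ := h
  obtain ⟨D, hD, h2⟩ := sqrt_le_ll (1 + δ) (by linarith)
  have hK0 : 0 ≤ K := (abs_nonneg _).trans (hK 0)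
  refine ⟨C + K * D, by positivity, fun N => ?_⟩
  rcases Nat.eq_zero_or_pos N with rfl | hN
  · simp [h0]
  have hN1 : (1:ℝ) ≤ N := by exact_mod_cast hN
  have a1 := h2 N hN1
  have a2 : 1 ≤ (N:ℝ) ^ (1/2:ℝ) := Real.one_le_rpow hN1 (by norm_num)
  have e : ∑ n ∈ Finset.range (N + 1), e' n = ∑ n ∈ Finset.range (N + 1), e n +
      ∑ n ∈ Finset.range (N + 1), (e' n - e n) := by
    rw [← Finset.sum_add_distrib]; simp
  rw [e]
  refine (abs_add_le _ _).trans ((add_le_add (h N) (hK N)).trans ?_)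
  have : K * 1 ≤ K * (D * N * ll N ^ (-(1 + δ))) := by gcongr; linarith
  linarith

/-- primes coprime to the modulus -/
noncomputable def f0 {d : ℕ} (χ : DirichletCharacter ℂ d) (n : ℕ) : ℝ := cr χ n ^ 2 * pr n
/-- primes weighted by the character -/
noncomputable def f1 {d : ℕ} (χ : DirichletCharacter ℂ d) (n : ℕ) : ℝ := cr χ n * pr n

open ArithmeticFunction in
lemma PB_main {d : ℕ} [NeZero d] {χ : DirichletCharacter ℂ d} (hq : MulChar.IsQuadratic χ) (hne : χ ≠ 1) :
    ∃ δ : ℝ, 0 < δ ∧ δ ≤ 1 ∧ PB δ (f1 χ) ∧ PB δ (fun n => f0 χ n - 1 / lg n) := by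
  obtain ⟨δ, h0, h1, C, hC, h⟩ := main_sums hq hne
  refine ⟨δ, h0, h1, ?_, ?_⟩
  · have := abel_log (E := fun n => cr χ n * (pr n * lg n ^ 2)) (by simp [lg]) (by simp [lg]) h0 h1
      ⟨C + 32, by positivity, fun N => ?_⟩
    · convert this using 1
      ext n
      rcases lt_or_ge n 2 with hn | hn
      · have : pr n = 0 := pr_not (fun hp => by have := hp.two_le; omega)
        simp [f1, this]
      · have := (lg_pos hn).ne'
        rw [f1]; field_simp
    · have a := drop_powers (cr χ) (cr_abs hq) N
      have b := (h N).2
      have e : 1 ≤ ll N ^ (1 - δ) := Real.one_le_rpow (ll_one (by positivity)) (by linarith)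
      have hN : (0:ℝ) ≤ N := by positivity
      have c : (N:ℝ) ≤ N * ll N ^ (1 - δ) := le_mul_of_one_le_right hN e
      rw [abs_le] at a b ⊢
      constructor <;> nlinarith
  · have := abel_log (E := fun n => 1 * (pr n * lg n ^ 2) - lg n) (by simp [lg]) (by simp [lg]) h0 h1
      ⟨C + 32, by positivity, fun N => ?_⟩
    · refine PB_bounded h0 this d.primeFactors.card (fun N => ?_) ?_
      · have hpt : ∀ n ∈ Finset.range (N + 1), |(f0 χ n - 1 / lg n) - (1 * (pr n * lg n ^ 2) - lg n) / lg n ^ 2|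
            ≤ if n ∈ d.primeFactors then 1 else 0 := by
          intro n _
          rcases lt_or_ge n 2 with hn | hn
          · have h1 : pr n = 0 := pr_not (fun hp => by have := hp.two_le; omega)
            have h2 : lg n = 0 := by interval_cases n <;> simp [lg]
            simp [f0, h1, h2]
            split_ifs <;> norm_num
          · have hl := (lg_pos hn).ne'
            have e : (f0 χ n - 1 / lg n) - (1 * (pr n * lg n ^ 2) - lg n) / lg n ^ 2 = (cr χ n ^ 2 - 1) * pr n := by
              rw [f0]; field_simp; ring
            rw [e]
            by_cases hp : n.Prime
            · rw [pr_of hp]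
              split_ifs with hm
              · rcases cr_cases hq n with h | h | h <;> simp [h]
              · have hcop : IsUnit (n : ZMod d) := by
                  rw [ZMod.isUnit_iff_coprime]
                  rw [hp.coprime_iff_not_dvd]
                  intro hdvd
                  exact hm (Nat.mem_primeFactors.mpr ⟨hp, hdvd, NeZero.ne d⟩)
                have : χ (n : ZMod d) ≠ 0 := by
                  exact (hcop.map χ).ne_zero
                rw [cr_eq hq] at this
                have h3 : cr χ n ≠ 0 := by exact_mod_cast this
                rcases cr_cases hq n with h | h | h
                · exact absurd h h3
                · simp [h]
                · simp [h]
            · rw [pr_not hp]; simp; split_ifs <;> norm_num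
        refine (Finset.abs_sum_le_sum_abs _ _).trans ((Finset.sum_le_sum hpt).trans ?_)
        rw [Finset.sum_ite_mem, Finset.sum_const, nsmul_eq_mul, mul_one]
        exact_mod_cast Finset.card_le_card Finset.inter_subset_right
      · simp [f0, pr_not Nat.not_prime_zero, lg]
    · have a := drop_powers (fun _ => 1) (by simp) N
      have b := (h N).1
      have e : 1 ≤ ll N ^ (1 - δ) := Real.one_le_rpow (ll_one (by positivity)) (by linarith)
      have hN : (0:ℝ) ≤ N := by positivity
      have c : (N:ℝ) ≤ N * ll N ^ (1 - δ) := le_mul_of_one_le_right hN e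
      rw [Finset.sum_sub_distrib] at b ⊢
      simp only [one_mul] at a ⊢
      rw [abs_le] at a b ⊢
      constructor <;> nlinarith

lemma summable_ll {δ : ℝ} (hδ : 0 < δ) : Summable (fun n : ℕ => ll n ^ (-(1 + δ)) / (n + 1)) := by
  have l1 : ∀ n : ℕ, 1 ≤ ll n := fun n => ll_one (by positivity)
  rw [← summable_condensed_iff_of_nonneg]
  · have hs : Summable (fun k : ℕ => (2:ℝ) ^ (1 + δ) * (1 / ((k + 1 : ℕ) : ℝ) ^ (1 + δ))) :=
      ((summable_nat_add_iff 1).mpr (Real.summable_one_div_nat_rpow.mpr (by linarith : 1 < 1 + δ))).mul_left _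
    refine hs.of_nonneg_of_le (fun k => ?_) (fun k => ?_)
    · have := l1 (2 ^ k); positivity
    · have h1 : ((k:ℝ) + 1) / 2 ≤ ll ((2 ^ k : ℕ) : ℝ) := by
        unfold ll
        have : Real.log ((2:ℝ) ^ k) ≤ Real.log (1 + ((2 ^ k : ℕ) : ℝ)) :=
          Real.log_le_log (by positivity) (by push_cast; linarith)
        rw [Real.log_pow] at this
        have h2 := Real.log_two_gt_d9
        have hk : (0:ℝ) ≤ k := by positivity
        nlinarith
      have h2 := Real.rpow_le_rpow_of_nonpos (by positivity) h1 (by linarith : -(1 + δ) ≤ 0)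
      have h3 : (2:ℝ) ^ k * (ll ((2 ^ k : ℕ) : ℝ) ^ (-(1 + δ)) / (((2 ^ k : ℕ) : ℝ) + 1)) ≤ ll ((2 ^ k : ℕ) : ℝ) ^ (-(1 + δ)) := by
        have := l1 (2 ^ k)
        have hp : 0 ≤ ll ((2 ^ k : ℕ) : ℝ) ^ (-(1 + δ)) := by positivity
        rw [mul_div_assoc', div_le_iff₀ (by positivity)]
        push_cast at *
        nlinarith
      refine h3.trans (h2.trans (le_of_eq ?_))
      rw [Real.rpow_neg (by positivity), Real.div_rpow (by positivity) (by norm_num)]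
      push_cast
      field_simp
  · intro n
    have := l1 n; positivity
  · intro m n _ hmn
    have := l1 m
    have h2 := Real.rpow_le_rpow_of_nonpos (by linarith : 0 < ll m) (ll_mono (by positivity) (show (m:ℝ) ≤ n by exact_mod_cast hmn))
      (by linarith : -(1 + δ) ≤ 0)
    have := l1 n
    have hp : 0 ≤ ll n ^ (-(1 + δ)) := by positivity
    gcongr

lemma tendsto_ll : Tendsto ll atTop atTop := by
  unfold ll
  refine tendsto_atTop_add_const_left _ _ (Real.tendsto_log_atTop.comp (tendsto_atTop_add_const_left _ _ tendsto_id))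

lemma PB_conv {δ : ℝ} (hδ : 0 < δ) {e : ℕ → ℝ} (h : PB δ e) (h0 : e 0 = 0) (h1 : e 1 = 0) :
    ∃ L : ℝ, Tendsto (fun N : ℕ => ∑ n ∈ Finset.range N, e n / n) atTop (𝓝 L) := by
  obtain ⟨C, hC, h⟩ := h
  set S : ℕ → ℝ := fun n => ∑ i ∈ Finset.range (n + 1), e i with hS
  have hsum : Summable (fun n : ℕ => S n * (1 / (n:ℝ) - 1 / ((n + 1 : ℕ):ℝ))) := by
    refine Summable.of_norm_bounded ((summable_ll hδ).mul_left C) fun n => ?_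
    rcases Nat.eq_zero_or_pos n with rfl | hn
    · simp [hS, h0]; have := ll_one (le_refl (0:ℝ)); positivity
    have hn0 : (0:ℝ) < n := by exact_mod_cast hn
    have e1 : (1 / (n:ℝ) - 1 / ((n + 1 : ℕ):ℝ)) = 1 / (n * (n + 1)) := by push_cast; field_simp; ring
    rw [Real.norm_eq_abs, abs_mul, e1, abs_of_pos (by positivity : 0 < 1 / ((n:ℝ) * (n + 1)))]
    calc _ ≤ C * n * ll n ^ (-(1 + δ)) * (1 / ((n:ℝ) * (n + 1))) := by gcongr; exact h n
      _ = _ := by field_simp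
  have ht := hsum.hasSum.tendsto_sum_nat
  set T := ∑' n : ℕ, S n * (1 / (n:ℝ) - 1 / ((n + 1 : ℕ):ℝ))
  have hSN : Tendsto (fun N : ℕ => S N * (1 / (N:ℝ))) atTop (𝓝 0) := by
    have b : Tendsto (fun N : ℕ => C * ll N ^ (-(1 + δ))) atTop (𝓝 0) := by
      have := ((tendsto_rpow_neg_atTop (show 0 < 1 + δ by linarith)).comp (tendsto_ll.comp tendsto_natCast_atTop_atTop)).const_mul C
      simpa using this
    refine squeeze_zero_norm (fun N => ?_) b
    rcases Nat.eq_zero_or_pos N with rfl | hn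
    · simp; have := ll_one (le_refl (0:ℝ)); positivity
    have hn0 : (0:ℝ) < N := by exact_mod_cast hn
    rw [Real.norm_eq_abs, abs_mul, abs_of_pos (by positivity : 0 < 1 / (N:ℝ))]
    calc _ ≤ C * N * ll N ^ (-(1 + δ)) * (1 / (N:ℝ)) := by gcongr; exact h N
      _ = _ := by field_simp
  refine ⟨T, ?_⟩
  rw [← tendsto_add_atTop_iff_nat 1]
  have := hSN.add ht
  rw [zero_add] at this
  refine this.congr' ?_
  filter_upwards [eventually_ge_atTop 2] with N hN
  have ab := abel_id e (fun n => 1 / (n:ℝ)) hN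
  rw [h0, h1, add_zero, zero_mul, sub_zero] at ab
  have s1 : ∑ n ∈ Finset.range (N + 1), e n / n = ∑ n ∈ Finset.Ico 2 (N + 1), e n * (1 / (n:ℝ)) := by
    rw [Finset.sum_Ico_eq_sub _ (by omega)]
    simp [Finset.sum_range_succ, h0, h1, div_eq_mul_inv]
  have s2 : ∑ n ∈ Finset.Ico 2 N, S n * (1 / (n:ℝ) - 1 / ((n + 1 : ℕ):ℝ)) =
      ∑ n ∈ Finset.range N, S n * (1 / (n:ℝ) - 1 / ((n + 1 : ℕ):ℝ)) := by
    rw [Finset.sum_Ico_eq_sub _ hN]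
    simp [Finset.sum_range_succ, h0, h1, hS]
  rw [s1, ab, ← s2]

lemma sum_inv_nlog {N : ℕ} (hN : 2 ≤ N) :
    Real.log (Real.log N) - Real.log (Real.log 2) ≤ ∑ n ∈ Finset.range (N + 1), 1 / lg n / n ∧
    ∑ n ∈ Finset.range (N + 1), 1 / lg n / n ≤ Real.log (Real.log N) - Real.log (Real.log 2) + 1 := by
  have hb : ∑ n ∈ Finset.range (2 + 1), 1 / lg n / n = 1 / Real.log 2 / 2 := by
    simp [Finset.sum_range_succ, lg]
  have hstep : ∀ n : ℕ, 2 ≤ n → 1 / lg (n + 1) / ((n + 1 : ℕ):ℝ) ≤ Real.log (Real.log (n + 1 : ℕ)) - Real.log (Real.log n) ∧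
      Real.log (Real.log (n + 1 : ℕ)) - Real.log (Real.log n) ≤ 1 / lg n / n := by
    intro n hn
    have h1 := lg_pos hn
    have h2 := lg_pos (show 2 ≤ n + 1 by omega)
    have hn0 : (0:ℝ) < n := by positivity
    have u : lg (n + 1) - lg n ≤ 1 / n := by
      unfold lg
      rw [← Real.log_div (by positivity) (by positivity)]
      have := Real.log_le_sub_one_of_pos (show 0 < (((n + 1 : ℕ):ℝ)) / n by positivity)
      refine this.trans (le_of_eq ?_)
      push_cast
      field_simp; ring
    have l : 1 / ((n + 1 : ℕ):ℝ) ≤ lg (n + 1) - lg n := by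
      unfold lg
      rw [← Real.log_div (by positivity) (by positivity)]
      have := Real.one_sub_inv_le_log_of_pos (show 0 < (((n + 1 : ℕ):ℝ)) / n by positivity)
      refine le_trans (le_of_eq ?_) this
      push_cast
      field_simp; ring
    change _ ≤ Real.log (lg (n + 1)) - Real.log (lg n) ∧ Real.log (lg (n + 1)) - Real.log (lg n) ≤ _
    rw [← Real.log_div h2.ne' h1.ne']
    constructor
    · have := Real.one_sub_inv_le_log_of_pos (show 0 < lg (n + 1) / lg n by positivity)
      refine le_trans ?_ this
      have e : 1 - (lg (n + 1) / lg n)⁻¹ = (lg (n + 1) - lg n) / lg (n + 1) := by field_simp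
      rw [e, div_div, mul_comm, ← div_div]
      gcongr
    · have := Real.log_le_sub_one_of_pos (show 0 < lg (n + 1) / lg n by positivity)
      refine this.trans ?_
      have e : (lg (n + 1) / lg n) - 1 = (lg (n + 1) - lg n) / lg n := by field_simp
      rw [e, div_div, mul_comm, ← div_div]
      gcongr
  have hl2 := Real.log_two_gt_d9
  have hl3 := Real.log_two_lt_d9
  have c0 : 1 / Real.log 2 / 2 ≤ 1 := by
    rw [div_div, div_le_one (by positivity)]; linarith
  have main : Real.log (Real.log (N + 1 : ℕ)) - Real.log (Real.log 2) ≤ ∑ n ∈ Finset.range (N + 1), 1 / lg n / n ∧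
    ∑ n ∈ Finset.range (N + 1), 1 / lg n / n ≤ Real.log (Real.log N) - Real.log (Real.log 2) + 1 := by
    induction N, hN using Nat.le_induction with
    | base => 
      rw [hb]
      have := (hstep 2 le_rfl).2
      simp only [lg] at this
      constructor
      · exact_mod_cast this
      · simp only [Nat.cast_ofNat]; linarith
    | succ N hN ih =>
      rw [Finset.sum_range_succ]
      have s1 := (hstep N hN).1
      have s2 := (hstep (N + 1) (by omega)).2
      constructor
      · linarith [ih.1]
      · linarith [ih.2]
  refine ⟨le_trans ?_ main.1, main.2⟩
  have h1 : 0 < Real.log N := lg_pos hN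
  have : Real.log N ≤ Real.log (N + 1 : ℕ) := Real.log_le_log (by positivity) (by push_cast; linarith)
  linarith [Real.log_le_log h1 this]

end DGK

namespace DGK
open Complex MeasureTheory Set Topology

/-- summatory function -/
noncomputable def Fs (f : ℕ → ℝ) (y : ℝ) : ℝ := ∑ n ∈ Finset.range (⌊y⌋₊ + 1), f n

lemma floor_ll {y a : ℝ} (hy : 1 ≤ y) (ha : 0 ≤ a) : ll (⌊y⌋₊ : ℝ) ^ (-a) ≤ 2 ^ a * ll y ^ (-a) := by
  have h1 : (1:ℝ) ≤ ⌊y⌋₊ := by exact_mod_cast Nat.le_floor (by exact_mod_cast hy)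
  have h2 := Nat.lt_floor_add_one y
  have h3 : ll y ≤ 2 * ll ⌊y⌋₊ := (ll_mono (by linarith) (by linarith)).trans (ll_two (by linarith))
  have h0 := ll_one (show 0 ≤ y by linarith)
  have h4 := Real.rpow_le_rpow_of_nonpos (by linarith : 0 < ll y / 2) (by linarith : ll y / 2 ≤ ll ⌊y⌋₊) (by linarith : -a ≤ 0)
  rw [Real.div_rpow (by linarith) (by norm_num), Real.rpow_neg (by norm_num : (0:ℝ) ≤ 2), div_inv_eq_mul] at h4
  linarith

lemma PB_real {δ : ℝ} (hδ : 0 < δ) {e : ℕ → ℝ} (h : PB δ e) :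
    ∃ C : ℝ, 0 ≤ C ∧ ∀ y : ℝ, 1 ≤ y → |Fs e y| ≤ C * y * ll y ^ (-(1 + δ)) := by
  obtain ⟨C, hC, h⟩ := h
  refine ⟨C * 2 ^ (1 + δ), by positivity, fun y hy => ?_⟩
  have a := floor_ll hy (show 0 ≤ 1 + δ by linarith)
  have b := Nat.floor_le (show 0 ≤ y by linarith)
  have c := ll_one (show (0:ℝ) ≤ ⌊y⌋₊ by positivity)
  refine (h ⌊y⌋₊).trans ?_
  calc _ ≤ C * y * (2 ^ (1 + δ) * ll y ^ (-(1 + δ))) := by gcongr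
    _ = _ := by ring

lemma Li_bound : ∃ C : ℝ, 0 ≤ C ∧ ∀ y : ℝ, 2 ≤ y → |Fs (fun n => 1 / lg n) y - y / Real.log y| ≤ C * y * ll y ^ (-2 : ℝ) := by
  obtain ⟨C, hC, hs⟩ := sum_ll_le 2 (by norm_num)
  obtain ⟨D, hD, hD2⟩ := sqrt_le_ll 2 (by norm_num)
  refine ⟨10 * D + 32 * C * 4, by positivity, fun y hy => ?_⟩
  have hN : 2 ≤ ⌊y⌋₊ := Nat.le_floor (by exact_mod_cast hy)
  have hl4 := floor_ll (show 1 ≤ y by linarith) (show (0:ℝ) ≤ 2 by norm_num)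
  have hfl := Nat.floor_le (show 0 ≤ y by linarith)
  have hfl2 := Nat.lt_floor_add_one y
  have ab := abel_id (fun _ => 1) (fun n => 1 / lg n) hN
  unfold Fs
  generalize ⌊y⌋₊ = N at *
  have hN2 : (2:ℝ) ≤ N := by exact_mod_cast hN
  have e0 : ∑ n ∈ Finset.range (N + 1), 1 / lg n = ∑ n ∈ Finset.Ico 2 (N + 1), 1 * (1 / lg n) := by
    rw [Finset.sum_Ico_eq_sub _ (by omega)]
    simp [Finset.sum_range_succ, lg]
  rw [e0, ab]
  simp only [Finset.sum_const, Finset.card_range, nsmul_eq_mul, mul_one]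
  have t1 : |∑ n ∈ Finset.Ico 2 N, ((n + 1 : ℕ) : ℝ) * (1 / lg n - 1 / lg (n + 1))| ≤ 32 * (C * N * ll N ^ (-2:ℝ)) := by
    refine (Finset.abs_sum_le_sum_abs _ _).trans ?_
    have : ∑ n ∈ Finset.Ico 2 N, |((n + 1 : ℕ) : ℝ) * (1 / lg n - 1 / lg (n + 1))| ≤ ∑ n ∈ Finset.Ico 2 N, 32 * ll n ^ (-2:ℝ) := by
      refine Finset.sum_le_sum fun n hn => ?_
      have hn2 := (Finset.mem_Ico.mp hn).1
      have hn0 : (2:ℝ) ≤ n := by exact_mod_cast hn2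
      have h1 := lg_pos hn2
      have h2 : lg n ≤ lg (n + 1) := Real.log_le_log (by linarith) (by push_cast; linarith)
      have u : lg (n + 1) - lg n ≤ 1 / n := by
        unfold lg
        rw [← Real.log_div (by positivity) (by positivity)]
        have := Real.log_le_sub_one_of_pos (show 0 < (((n + 1 : ℕ):ℝ)) / n by positivity)
        refine this.trans (le_of_eq ?_)
        push_cast
        field_simp; ring
      have h3 : 0 < lg (n + 1) := by linarith
      have e : 1 / lg n - 1 / lg (n + 1) = (lg (n + 1) - lg n) / (lg n * lg (n + 1)) := by field_simp
      have q1 : 0 ≤ (lg (n+1) - lg n)/(lg n * lg (n+1)) := div_nonneg (by linarith) (by positivity)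
      have q2 : (0:ℝ) ≤ ((n+1:ℕ):ℝ) := by positivity
      rw [e, abs_mul, abs_of_nonneg q1, abs_of_nonneg q2]
      have l4 : ll n ≤ 4 * lg n := ll_le_log hn0
      have l1 := ll_one (show (0:ℝ) ≤ n by linarith)
      have a3 : 1 / lg n ^ 2 ≤ 16 * ll n ^ (-2 : ℝ) := by
        rw [Real.rpow_neg (by linarith), ← div_eq_mul_inv, div_le_div_iff₀ (by positivity) (by positivity)]
        norm_cast
        nlinarith
      calc _ ≤ (2 * n) * ((1 / n) / (lg n * lg n)) := by
            gcongr
            push_cast; linarith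
        _ = 2 * (1 / lg n ^ 2) := by field_simp
        _ ≤ _ := by linarith
    refine this.trans ?_
    rw [← Finset.mul_sum]
    gcongr
    refine le_trans ?_ (hs N (by omega))
    refine Finset.sum_le_sum_of_subset_of_nonneg (fun n hn => by simp at hn ⊢; omega) fun n _ _ => ?_
    have := ll_one (show (0:ℝ) ≤ n by positivity)
    positivity
  have t2 : 1 ≤ D * y * ll y ^ (-2:ℝ) :=
    (Real.one_le_rpow (show 1 ≤ y by linarith) (by norm_num)).trans (hD2 y (by linarith))
  have hlN := log_two_le hN
  have hlg : lg N = Real.log N := rfl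
  have hlNy : Real.log N ≤ Real.log y := Real.log_le_log (by linarith) hfl
  have t3 : |((N + 1 : ℕ) : ℝ) * (1 / lg N) - y / Real.log y| ≤ 6 := by
    have u : Real.log y - Real.log N ≤ 1 / N := by
      rw [← Real.log_div (by positivity) (by positivity)]
      have := Real.log_le_sub_one_of_pos (show 0 < y / N by positivity)
      refine this.trans ?_
      rw [div_sub_one (by positivity)]; gcongr; linarith
    rw [hlg]
    set a := Real.log N
    set b := Real.log y
    have ha : 0 < a := by linarith
    have hb : 0 < b := by linarith
    have e : ((N + 1 : ℕ) : ℝ) * (1 / a) - y / b = (N + 1 - y) / a + y * (b - a) / (a * b) := by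
      push_cast; field_simp; ring
    rw [e, abs_of_nonneg (add_nonneg (div_nonneg (by linarith) ha.le) (div_nonneg (mul_nonneg (by linarith) (by linarith)) (by positivity)))]
    have p1 : (N + 1 - y) / a ≤ 1 / 0.69 := by
      gcongr; linarith
    have p2 : y * (b - a) / (a * b) ≤ (1.5 * N) * (1 / N) / (0.69 * 0.69) := by
      gcongr
      · linarith
      · linarith
    have p3 : (1.5 * N) * (1 / N) / (0.69 * 0.69) = 1.5 / (0.69 * 0.69 : ℝ) := by field_simp
    rw [p3] at p2
    norm_num at p1 p2 ⊢
    linarith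
  have t4 : |(((1:ℝ) + 1) * (1 / lg 2))| ≤ 4 := by
    have := Real.log_two_gt_d9
    have e : lg 2 = Real.log 2 := by simp [lg]
    rw [e, abs_of_nonneg (by positivity), mul_one_div, div_le_iff₀ (by positivity)]
    linarith
  have t5 : 32 * (C * N * ll N ^ (-2:ℝ)) ≤ 32 * C * 4 * y * ll y ^ (-2:ℝ) := by
    have l1 := ll_one (show (0:ℝ) ≤ N by linarith)
    calc _ ≤ 32 * (C * y * (2 ^ (2:ℝ) * ll y ^ (-2:ℝ))) := by gcongr
      _ = _ := by
        have : (2:ℝ) ^ (2:ℝ) = 4 := by norm_num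
        rw [this]; ring
  have fin : ((N + 1 : ℕ) : ℝ) * (1 / lg N) - (1 + 1) * (1 / lg 2) +
      ∑ n ∈ Finset.Ico 2 N, ((n + 1 : ℕ) : ℝ) * (1 / lg n - 1 / lg (n + 1)) - y / Real.log y =
      (((N + 1 : ℕ) : ℝ) * (1 / lg N) - y / Real.log y) - (1 + 1) * (1 / lg 2) +
      ∑ n ∈ Finset.Ico 2 N, ((n + 1 : ℕ) : ℝ) * (1 / lg n - 1 / lg (n + 1)) := by ring
  rw [fin]
  refine (abs_add_le _ _).trans ?_
  have := abs_sub (((N + 1 : ℕ) : ℝ) * (1 / lg N) - y / Real.log y) ((1 + 1) * (1 / lg 2))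
  nlinarith

lemma F0_bound {δ : ℝ} (hδ : 0 < δ) (hδ1 : δ ≤ 1) {f : ℕ → ℝ} (h : PB δ (fun n => f n - 1 / lg n)) :
    ∃ C : ℝ, 0 ≤ C ∧ ∀ y : ℝ, 2 ≤ y → |Fs f y - y / Real.log y| ≤ C * y * ll y ^ (-(1 + δ)) := by
  obtain ⟨C, hC, h⟩ := PB_real hδ h
  obtain ⟨D, hD, h2⟩ := Li_bound
  refine ⟨C + D, by positivity, fun y hy => ?_⟩
  have a := h y (by linarith)
  have b := h2 y hy
  have l1 := ll_one (show 0 ≤ y by linarith)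
  have c : D * y * ll y ^ (-2:ℝ) ≤ D * y * ll y ^ (-(1 + δ)) := by gcongr; linarith
  have e : Fs f y - y / Real.log y = Fs (fun n => f n - 1 / lg n) y + (Fs (fun n => 1 / lg n) y - y / Real.log y) := by
    simp only [Fs, Finset.sum_sub_distrib]; ring
  rw [e]
  refine (abs_add_le _ _).trans ?_
  linarith

lemma toep {a : ℕ → ℝ} {L : ℝ} (hA : Tendsto (fun N : ℕ => ∑ n ∈ Finset.range N, a n) atTop (𝓝 L))
    {v : ℝ → ℕ → ℝ} {M : ℝ → ℕ} (hM : Tendsto M atTop atTop)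
    (hv0 : ∀ᶠ x in atTop, v x 0 = 0)
    (hmono : ∀ᶠ x in atTop, ∀ n < M x, v x n ≤ v x (n + 1))
    (hv1 : ∀ᶠ x in atTop, v x (M x) ≤ 1)
    (hlim : ∀ n, Tendsto (fun x => v x n) atTop (𝓝 0)) :
    Tendsto (fun x => ∑ n ∈ Finset.range (M x + 1), a n * v x n) atTop (𝓝 0) := by
  set A : ℕ → ℝ := fun N => ∑ n ∈ Finset.range N, a n with hAdef
  have abel : ∀ (u : ℕ → ℝ) (N : ℕ), ∑ n ∈ Finset.range (N + 1), a n * u n =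
      A (N + 1) * u 0 + ∑ n ∈ Finset.range N, (A (N + 1) - A (n + 1)) * (u (n + 1) - u n) := by
    intro u N
    induction N with
    | zero => simp [hAdef]
    | succ N ih =>
      have e1 : A (N + 1 + 1) = A (N + 1) + a (N + 1) := Finset.sum_range_succ _ _
      have e2 : ∑ n ∈ Finset.range (N + 1), (u (n + 1) - u n) = u (N + 1) - u 0 := Finset.sum_range_sub u (N + 1)
      rw [Finset.sum_range_succ, ih]
      have e3 : ∑ n ∈ Finset.range (N + 1), (A (N + 1 + 1) - A (n + 1)) * (u (n + 1) - u n) =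
          ∑ n ∈ Finset.range (N + 1), ((A (N + 1) - A (n + 1)) * (u (n + 1) - u n)) +
          a (N + 1) * ∑ n ∈ Finset.range (N + 1), (u (n + 1) - u n) := by
        rw [Finset.mul_sum, ← Finset.sum_add_distrib]
        refine Finset.sum_congr rfl fun n _ => ?_
        rw [e1]; ring
      rw [e3, e2, Finset.sum_range_succ (fun n => (A (N + 1) - A (n + 1)) * (u (n + 1) - u n)), e1]
      ring
  obtain ⟨B, hB⟩ : ∃ B, ∀ n, |A n| ≤ B := by
    obtain ⟨B, hB⟩ := hA.abs.bddAbove_range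
    exact ⟨B, fun n => hB ⟨n, rfl⟩⟩
  have hB0 : 0 ≤ B := (abs_nonneg _).trans (hB 0)
  rw [Metric.tendsto_nhds]
  intro ε hε
  obtain ⟨K, hK⟩ := Metric.tendsto_atTop.mp hA (ε / 8) (by positivity)
  have hlimK := (Metric.tendsto_nhds.mp (hlim K)) (ε / (4 * (B + 1))) (by positivity)
  filter_upwards [hv0, hmono, hv1, hlimK, hM.eventually_ge_atTop K] with x h0 hm h1 hk hMK
  rw [abel, h0, mul_zero, zero_add, Real.dist_eq, sub_zero]
  rw [Real.dist_eq, sub_zero] at hk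
  have hbound : ∀ n ∈ Finset.range (M x), |(A (M x + 1) - A (n + 1)) * (v x (n + 1) - v x n)| ≤
      (if n < K then 2 * B * (v x (n + 1) - v x n) else 0) + ε / 4 * (v x (n + 1) - v x n) := by
    intro n hn
    have hn' := Finset.mem_range.mp hn
    have hd : 0 ≤ v x (n + 1) - v x n := by linarith [hm n hn']
    rw [abs_mul, abs_of_nonneg hd]
    split_ifs with hc
    · have : |A (M x + 1) - A (n + 1)| ≤ 2 * B := (abs_sub _ _).trans (by linarith [hB (M x + 1), hB (n + 1)])
      have h3 : 0 ≤ ε / 4 * (v x (n + 1) - v x n) := by positivity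
      nlinarith
    · have k1 := hK (M x + 1) (by omega)
      have k2 := hK (n + 1) (by omega)
      rw [Real.dist_eq, abs_lt] at k1 k2
      have : |A (M x + 1) - A (n + 1)| ≤ ε / 4 := by
        rw [abs_le]; constructor <;> linarith [k1.1, k1.2, k2.1, k2.2]
      rw [zero_add]
      gcongr
  refine ((Finset.abs_sum_le_sum_abs _ _).trans (Finset.sum_le_sum hbound)).trans_lt ?_
  rw [Finset.sum_add_distrib, ← Finset.mul_sum, Finset.sum_range_sub, h0, ← Finset.sum_filter]
  have ef : (Finset.range (M x)).filter (fun n => n < K) = Finset.range K := by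
    ext n; simp; omega
  rw [ef, ← Finset.mul_sum, Finset.sum_range_sub, h0, sub_zero, sub_zero]
  have hk2 : v x K < ε / (4 * (B + 1)) := (le_abs_self _).trans_lt hk
  rw [lt_div_iff₀ (by positivity)] at hk2
  have hk3 : 0 ≤ |v x K| := abs_nonneg _
  have hvK : 2 * B * v x K ≤ ε / 2 := by
    have : v x K * (4 * (B + 1)) ≤ ε := hk2.le
    by_cases hs : 0 ≤ v x K
    · nlinarith
    · push Not at hs
      nlinarith
  nlinarith

end DGK

namespace DGK
open Complex MeasureTheory Set Topology

/-- sum over pairs below the hyperbola -/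
noncomputable def PP (f g : ℕ → ℝ) (N : ℕ) : ℝ :=
  ∑ m ∈ Finset.range (N + 1), ∑ n ∈ Finset.range (N + 1), if m * n ≤ N then f m * g n else 0

lemma hyp1 {f g : ℕ → ℝ} (hf : f 0 = 0) {N M : ℕ} (hM : ∀ m, m ≤ M ↔ m * m ≤ N) :
    ∑ m ∈ Finset.range (M + 1), f m * ∑ n ∈ Finset.range (N / m + 1), g n =
    ∑ m ∈ Finset.range (N + 1), ∑ n ∈ Finset.range (N + 1), if m ≤ M ∧ m * n ≤ N then f m * g n else 0 := by
  have hMN : M ≤ N := by have := (hM M).mp le_rfl; nlinarith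
  have hsub : Finset.range (M + 1) ⊆ Finset.range (N + 1) := Finset.range_mono (by omega)
  rw [← Finset.sum_subset hsub (f := fun m => ∑ n ∈ Finset.range (N + 1), if m ≤ M ∧ m * n ≤ N then f m * g n else 0)]
  · refine Finset.sum_congr rfl fun m hm => ?_
    have hm' : m ≤ M := by simp at hm; omega
    rcases Nat.eq_zero_or_pos m with rfl | h0
    · simp [hf]
    · rw [Finset.mul_sum, ← Finset.sum_filter]
      refine Finset.sum_congr ?_ fun _ _ => rfl
      ext n
      simp only [Finset.mem_range, Finset.mem_filter, hm', true_and]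
      rw [Nat.lt_succ_iff, Nat.le_div_iff_mul_le h0, mul_comm n m]
      constructor
      · intro h; exact ⟨by nlinarith, h⟩
      · exact fun h => h.2
  · intro m _ hm
    have : ¬ m ≤ M := by simp at hm; omega
    simp [this]

lemma hyp {f g : ℕ → ℝ} (hf : f 0 = 0) (hg : g 0 = 0) {N M : ℕ} (hM : ∀ m, m ≤ M ↔ m * m ≤ N) :
    PP f g N = ∑ m ∈ Finset.range (M + 1), f m * ∑ n ∈ Finset.range (N / m + 1), g n
      + ∑ m ∈ Finset.range (M + 1), g m * ∑ n ∈ Finset.range (N / m + 1), f n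
      - (∑ m ∈ Finset.range (M + 1), f m) * ∑ m ∈ Finset.range (M + 1), g m := by
  have hMN : M ≤ N := by have := (hM M).mp le_rfl; nlinarith
  have hsub : Finset.range (M + 1) ⊆ Finset.range (N + 1) := Finset.range_mono (by omega)
  have h3 : (∑ m ∈ Finset.range (M + 1), f m) * ∑ m ∈ Finset.range (M + 1), g m =
      ∑ m ∈ Finset.range (N + 1), ∑ n ∈ Finset.range (N + 1), if m ≤ M ∧ n ≤ M then f m * g n else 0 := by
    rw [Finset.sum_mul_sum]
    have k : ∀ a : ℕ → ℝ, ∑ m ∈ Finset.range (M + 1), a m = ∑ m ∈ Finset.range (N + 1), if m ≤ M then a m else 0 := by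
      intro a
      rw [← Finset.sum_filter]
      refine Finset.sum_congr ?_ fun _ _ => rfl
      ext m; simp; omega
    rw [k]
    refine Finset.sum_congr rfl fun m _ => ?_
    rw [k]
    split_ifs with h
    · simp [h]
    · simp [h]
  rw [hyp1 hf hM, hyp1 hg hM, h3]
  rw [Finset.sum_comm (f := fun m n => if m ≤ M ∧ m * n ≤ N then g m * f n else 0)]
  unfold PP
  rw [← Finset.sum_add_distrib, ← Finset.sum_sub_distrib]
  refine Finset.sum_congr rfl fun m _ => ?_
  rw [← Finset.sum_add_distrib, ← Finset.sum_sub_distrib]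
  refine Finset.sum_congr rfl fun n _ => ?_
  rw [mul_comm n m, mul_comm (g n)]
  by_cases h : m * n ≤ N
  · simp only [h, and_true, if_true]
    by_cases h1 : m ≤ M <;> by_cases h2 : n ≤ M <;> simp [h1, h2]
    exfalso
    have a1 : M + 1 ≤ m := by omega
    have a2 : M + 1 ≤ n := by omega
    have a3 := (hM (M + 1)).mpr ((Nat.mul_le_mul a1 a2).trans h)
    omega
  · simp only [h, and_false, if_false]
    have : ¬ (m ≤ M ∧ n ≤ M) := fun ⟨h1, h2⟩ => h ((Nat.mul_le_mul h1 h2).trans ((hM M).mp le_rfl))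
    simp [this]

lemma hypR {f g : ℕ → ℝ} (hf : f 0 = 0) (hg : g 0 = 0) {x : ℝ} (hx : 0 ≤ x) :
    PP f g ⌊x⌋₊ = ∑ m ∈ Finset.range (⌊√x⌋₊ + 1), f m * Fs g (x / m)
      + ∑ m ∈ Finset.range (⌊√x⌋₊ + 1), g m * Fs f (x / m) - Fs f √x * Fs g √x := by
  rw [hyp hf hg (M := ⌊√x⌋₊)]
  · simp only [Fs, Nat.floor_div_natCast]
  · intro m
    rw [Nat.le_floor_iff (Real.sqrt_nonneg x), Nat.le_floor_iff hx, Real.le_sqrt (by positivity) hx]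
    push_cast
    rw [sq]

lemma card_pairs (Q : ℕ → ℕ → Prop) {g : ℕ → ℝ} {x : ℝ} (hx : 0 ≤ x)
    (h : ∀ p q, p.Prime → q.Prime → Q p q → g p * g q = 1)
    (h' : ∀ p q, ¬ (p.Prime ∧ q.Prime ∧ Q p q) → g p * g q = 0) :
    (Nat.card {pq : ℕ × ℕ // pq.1.Prime ∧ pq.2.Prime ∧ ((pq.1 * pq.2 : ℕ) : ℝ) ≤ x ∧ Q pq.1 pq.2} : ℝ)
      = PP g g ⌊x⌋₊ := by
  classical
  rw [Nat.subtype_card ((Finset.range (⌊x⌋₊ + 1) ×ˢ Finset.range (⌊x⌋₊ + 1)).filter fun pq =>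
    pq.1.Prime ∧ pq.2.Prime ∧ pq.1 * pq.2 ≤ ⌊x⌋₊ ∧ Q pq.1 pq.2)]
  · rw [Finset.card_filter, PP, ← Finset.sum_product']
    push_cast
    refine Finset.sum_congr rfl fun pq _ => ?_
    by_cases hc : pq.1.Prime ∧ pq.2.Prime ∧ Q pq.1 pq.2
    · rw [h _ _ hc.1 hc.2.1 hc.2.2]
      simp [hc.1, hc.2.1, hc.2.2]
    · rw [h' _ _ hc, ite_self, if_neg]
      exact fun k => hc ⟨k.1, k.2.1, k.2.2.2⟩
  · rintro ⟨p, q⟩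
    simp only [Finset.mem_filter, Finset.mem_product, Finset.mem_range, Nat.le_floor_iff hx]
    constructor
    · exact fun k => k.2
    · intro k
      refine ⟨?_, k⟩
      have k2 := (Nat.le_floor_iff hx).mpr k.2.2.1
      have := k.1.two_le
      have := k.2.1.two_le
      constructor <;> nlinarith

variable {d : ℕ} {χ : DirichletCharacter ℂ d}

lemma count_eta (hq : MulChar.IsQuadratic χ) {η : ℤ} (hη : η = 1 ∨ η = -1) {x : ℝ} (hx : 0 ≤ x) :
    (Nat.card {pq : ℕ × ℕ // pq.1.Prime ∧ pq.2.Prime ∧ ((pq.1 * pq.2 : ℕ) : ℝ) ≤ x ∧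
      (χ pq.1 = (η : ℂ) ∧ χ pq.2 = (η : ℂ))} : ℝ) = PP (fun n => (f0 χ n + η * f1 χ n) / 2) (fun n => (f0 χ n + η * f1 χ n) / 2) ⌊x⌋₊ := by
  have key : ∀ p : ℕ, (f0 χ p + η * f1 χ p) / 2 = if p.Prime ∧ χ p = (η : ℂ) then 1 else 0 := by
    intro p
    unfold f0 f1
    rw [cr_eq hq p]
    by_cases hp : p.Prime
    · rw [pr_of hp]
      rcases hη with rfl | rfl <;> rcases cr_cases hq p with c | c | c <;> rw [c] <;> norm_num [hp]
    · rw [pr_not hp]; simp [hp]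
  refine card_pairs (fun p q => χ p = (η : ℂ) ∧ χ q = (η : ℂ)) hx ?_ ?_
  · intro p q hp hq' hQ
    rw [key, key, if_pos ⟨hp, hQ.1⟩, if_pos ⟨hq', hQ.2⟩, one_mul]
  · intro p q hn
    rw [key, key]
    by_cases h1 : p.Prime ∧ χ p = (η : ℂ)
    · by_cases h2 : q.Prime ∧ χ q = (η : ℂ)
      · exact absurd ⟨h1.1, h2.1, h1.2, h2.2⟩ hn
      · rw [if_neg h2, mul_zero]
    · rw [if_neg h1, zero_mul]

lemma count_gcd (hq : MulChar.IsQuadratic χ) {x : ℝ} (hx : 0 ≤ x) :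
    (Nat.card {pq : ℕ × ℕ // pq.1.Prime ∧ pq.2.Prime ∧ ((pq.1 * pq.2 : ℕ) : ℝ) ≤ x ∧
      Nat.gcd (pq.1 * pq.2) d = 1} : ℝ) = PP (f0 χ) (f0 χ) ⌊x⌋₊ := by
  have key : ∀ p : ℕ, f0 χ p = if p.Prime ∧ Nat.Coprime p d then 1 else 0 := by
    intro p
    unfold f0
    by_cases hp : p.Prime
    · rw [pr_of hp]
      by_cases hc : Nat.Coprime p d
      · have u : IsUnit ((p : ZMod d)) := (ZMod.isUnit_iff_coprime p d).mpr hc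
        have := (u.map χ).ne_zero
        rw [if_pos ⟨hp, hc⟩]
        rcases cr_cases hq p with c | c | c
        · exfalso; rw [cr_eq hq p, c] at this; simp at this
        · rw [c]; norm_num
        · rw [c]; norm_num
      · have u : ¬ IsUnit ((p : ZMod d)) := fun k => hc ((ZMod.isUnit_iff_coprime p d).mp k)
        have := χ.map_nonunit u
        rw [if_neg (fun k => hc k.2)]
        simp [cr, this]
    · rw [pr_not hp]; simp [hp]
  refine card_pairs (fun p q => Nat.gcd (p * q) d = 1) hx ?_ ?_
  · intro p q hp hq' hQ
    have := Nat.coprime_mul_iff_left.mp hQ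
    rw [key, key, if_pos ⟨hp, this.1⟩, if_pos ⟨hq', this.2⟩, one_mul]
  · intro p q hn
    rw [key, key]
    by_cases h1 : p.Prime ∧ Nat.Coprime p d
    · by_cases h2 : q.Prime ∧ Nat.Coprime q d
      · exact absurd ⟨h1.1, h2.1, Nat.coprime_mul_iff_left.mpr ⟨h1.2, h2.2⟩⟩ hn
      · rw [if_neg h2, mul_zero]
    · rw [if_neg h1, zero_mul]

lemma PP_expand (a b : ℕ → ℝ) (η : ℝ) (hη : η ^ 2 = 1) (N : ℕ) :
    4 * PP (fun n => (a n + η * b n) / 2) (fun n => (a n + η * b n) / 2) N =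
    PP a a N + 2 * η * PP a b N + PP b b N := by
  have hs : PP a b N = PP b a N := by
    unfold PP
    rw [Finset.sum_comm]
    refine Finset.sum_congr rfl fun m _ => Finset.sum_congr rfl fun n _ => ?_
    rw [mul_comm n m, mul_comm (a n)]
  have : 2 * η * PP a b N = η * PP a b N + η * PP b a N := by rw [hs]; ring
  rw [this]
  unfold PP
  simp only [Finset.mul_sum]
  simp only [← Finset.sum_add_distrib]
  refine Finset.sum_congr rfl fun m _ => Finset.sum_congr rfl fun n _ => ?_
  split_ifs
  · linear_combination b m * b n * hη
  · ring

end DGK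

namespace DGK
open Complex MeasureTheory Set Topology

/-- floor of the square root -/
noncomputable def Mx (x : ℝ) : ℕ := ⌊√x⌋₊
/-- the weight -/
noncomputable def vv (x : ℝ) (m : ℕ) : ℝ := lg m / (Real.log x - lg m)

lemma Mx_tendsto : Tendsto Mx atTop atTop := tendsto_nat_floor_atTop.comp Real.tendsto_sqrt_atTop

lemma Mx_le {x : ℝ} {m : ℕ} (hm : m ≤ Mx x) : (m : ℝ) ≤ √x :=
  (Nat.le_floor_iff (Real.sqrt_nonneg x)).mp hm

lemma lg_Mx {x : ℝ} (hx : 1 ≤ x) {m : ℕ} (hm : m ≤ Mx x) : lg m ≤ Real.log x / 2 := by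
  rcases Nat.eq_zero_or_pos m with rfl | h0
  · have := Real.log_nonneg hx
    simp [lg]; linarith
  · rw [← Real.log_sqrt (by linarith)]
    exact Real.log_le_log (by exact_mod_cast h0) (Mx_le hm)

lemma vv_nonneg {x : ℝ} (hx : 1 < x) {m : ℕ} (hm : m ≤ Mx x) : 0 ≤ vv x m := by
  have := lg_Mx hx.le hm
  have := Real.log_pos hx
  exact div_nonneg (lg_nonneg m) (by linarith)

lemma toep_v {a : ℕ → ℝ} {L : ℝ} (hA : Tendsto (fun N : ℕ => ∑ n ∈ Finset.range N, a n) atTop (𝓝 L)) :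
    Tendsto (fun x => ∑ n ∈ Finset.range (Mx x + 1), a n * vv x n) atTop (𝓝 0) := by
  refine toep hA Mx_tendsto ?_ ?_ ?_ ?_
  · exact Eventually.of_forall fun x => by simp [vv, lg]
  · filter_upwards [eventually_gt_atTop 1] with x hx n hn
    have h1 := lg_Mx hx.le (show n + 1 ≤ Mx x by omega)
    have h2 := lg_Mx hx.le (show n ≤ Mx x by omega)
    have h3 := Real.log_pos hx
    have h4 : lg n ≤ lg (n + 1) := by
      rcases Nat.eq_zero_or_pos n with rfl | h0
      · simp [lg]
      · exact Real.log_le_log (by exact_mod_cast h0) (by push_cast; linarith)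
    have h5 := lg_nonneg n
    unfold vv
    apply div_le_div₀ (by linarith) h4 (by linarith) (by linarith)
  · filter_upwards [eventually_gt_atTop 1] with x hx
    have h1 := lg_Mx hx.le (le_refl (Mx x))
    have h3 := Real.log_pos hx
    unfold vv
    rw [div_le_one (by linarith)]
    linarith
  · intro n
    exact Tendsto.const_div_atTop (tendsto_atTop_add_const_right _ _ Real.tendsto_log_atTop) _

lemma loglog_Mx {x : ℝ} (hx : 16 ≤ x) : 2 ≤ Mx x ∧
    Real.log (Real.log x) - Real.log 4 ≤ Real.log (Real.log (Mx x)) ∧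
    Real.log (Real.log (Mx x)) ≤ Real.log (Real.log x) := by
  have s1 : 4 ≤ √x := by
    rw [Real.le_sqrt (by norm_num) (by linarith)]; linarith
  have s2 : 2 ≤ √(√x) := by
    rw [Real.le_sqrt (by norm_num) (by linarith)]; linarith
  have s3 : √(√x) * √(√x) = √x := Real.mul_self_sqrt (by linarith)
  have hM1 := Nat.lt_floor_add_one (√x)
  have h2 : 2 ≤ Mx x := Nat.le_floor (by push_cast; linarith)
  have hlx : 0 < Real.log x := Real.log_pos (by linarith)
  have hM : √(√x) ≤ (Mx x : ℝ) := by
    unfold Mx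
    nlinarith
  have a1 : Real.log x / 4 ≤ Real.log (Mx x) := by
    have : Real.log √(√x) = Real.log x / 4 := by
      rw [Real.log_sqrt (by linarith), Real.log_sqrt (by linarith)]; ring
    rw [← this]
    exact Real.log_le_log (by linarith) hM
  have a2 : Real.log (Mx x) ≤ Real.log x / 2 := lg_Mx (by linarith) le_rfl
  refine ⟨h2, ?_, Real.log_le_log (by linarith) (by linarith)⟩
  rw [← Real.log_div (by positivity) (by norm_num)]
  exact Real.log_le_log (by positivity) a1

lemma T_bound {f : ℕ → ℝ} {L : ℝ}
    (h : Tendsto (fun N : ℕ => ∑ n ∈ Finset.range N, (f n - 1 / lg n) / n) atTop (𝓝 L)) :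
    ∃ K, ∀ x : ℝ, 16 ≤ x → |∑ n ∈ Finset.range (Mx x + 1), f n / n - Real.log (Real.log x)| ≤ K := by
  obtain ⟨B, hB⟩ := h.abs.bddAbove_range
  refine ⟨B + (1 + |Real.log (Real.log 2)| + Real.log 4), fun x hx => ?_⟩
  have hb : |∑ n ∈ Finset.range (Mx x + 1), (f n - 1 / lg n) / n| ≤ B := hB ⟨Mx x + 1, rfl⟩
  obtain ⟨h2, h3, h4⟩ := loglog_Mx hx
  obtain ⟨s1, s2⟩ := sum_inv_nlog h2
  have e : ∑ n ∈ Finset.range (Mx x + 1), f n / n - Real.log (Real.log x) =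
      ∑ n ∈ Finset.range (Mx x + 1), (f n - 1 / lg n) / n +
      (∑ n ∈ Finset.range (Mx x + 1), 1 / lg n / n - Real.log (Real.log x)) := by
    rw [← add_sub_assoc, ← Finset.sum_add_distrib]
    congr 1
    exact Finset.sum_congr rfl fun n _ => by ring
  rw [e]
  refine (abs_add_le _ _).trans (add_le_add hb ?_)
  have l4 : 0 ≤ Real.log 4 := Real.log_nonneg (by norm_num)
  have := le_abs_self (Real.log (Real.log 2))
  have := neg_abs_le (Real.log (Real.log 2))
  rw [abs_le]
  constructor <;> linarith

/-- summatory function bound with main term -/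
def GB (δ : ℝ) (c : ℝ) (g : ℕ → ℝ) : Prop := ∃ C : ℝ, 0 ≤ C ∧ ∀ y : ℝ, 2 ≤ y →
  |Fs g y - c * (y / Real.log y)| ≤ C * y * ll y ^ (-(1 + δ))

lemma lim0 {δ : ℝ} (hδ : 0 < δ) (C K : ℝ) : Tendsto (fun x : ℝ =>
    C * (Real.log x / 2) ^ (-(1 + δ)) * Real.log x * (Real.log (Real.log x) + K)) atTop (𝓝 0) := by
  have h : Tendsto (fun w : ℝ => C * (w / 2) ^ (-(1 + δ)) * w * (Real.log w + K)) atTop (𝓝 0) := by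
    have a : Tendsto (fun w : ℝ => Real.log w / w ^ δ) atTop (𝓝 0) := (isLittleO_log_rpow_atTop hδ).tendsto_div_nhds_zero
    have b : Tendsto (fun w : ℝ => K * w ^ (-δ)) atTop (𝓝 0) := by
      simpa using (tendsto_rpow_neg_atTop hδ).const_mul K
    have c := (a.add b).const_mul (C * 2 ^ (1 + δ))
    simp only [add_zero, mul_zero] at c
    refine c.congr' ?_
    filter_upwards [eventually_gt_atTop 0] with w hw
    rw [Real.div_rpow hw.le (by norm_num), Real.rpow_neg (by norm_num : (0:ℝ) ≤ 2), div_inv_eq_mul,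
      neg_add, Real.rpow_add hw, Real.rpow_neg_one, div_eq_mul_inv (Real.log w), Real.rpow_neg hw.le]
    field_simp
  exact h.comp Real.tendsto_log_atTop

lemma ll_le_half {δ : ℝ} (hδ : 0 < δ) {y w : ℝ} (hw : 0 < w) (hy : 1 ≤ y) (h : w ≤ Real.log y) :
    ll y ^ (-(1 + δ)) ≤ w ^ (-(1 + δ)) := by
  have h1 : Real.log y ≤ ll y := by
    unfold ll
    have := Real.log_le_log (by linarith : 0 < y) (by linarith : y ≤ 1 + y)
    linarith
  exact Real.rpow_le_rpow_of_nonpos hw (by linarith) (by linarith)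

lemma err {δ c K : ℝ} (hδ : 0 < δ) {f g h : ℕ → ℝ} (hg : GB δ c g) (hf : ∀ n, |h n| ≤ f n) (h0 : h 0 = 0)
    (hT : ∀ x : ℝ, 16 ≤ x → |∑ n ∈ Finset.range (Mx x + 1), f n / n - Real.log (Real.log x)| ≤ K) :
    Tendsto (fun x : ℝ => (∑ m ∈ Finset.range (Mx x + 1), h m * Fs g (x / m)) * (Real.log x / x)
      - c * ∑ m ∈ Finset.range (Mx x + 1), h m / m * (1 + vv x m)) atTop (𝓝 0) := by
  obtain ⟨C, hC, hg⟩ := hg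
  refine squeeze_zero_norm' ?_ (lim0 hδ C K)
  filter_upwards [eventually_ge_atTop 16] with x hx
  have hx0 : 0 < x := by linarith
  have hlx : 0 < Real.log x := Real.log_pos (by linarith)
  rw [Real.norm_eq_abs, Finset.sum_mul, Finset.mul_sum, ← Finset.sum_sub_distrib]
  have s1 : 4 ≤ √x := by
    rw [Real.le_sqrt (by norm_num) (by linarith)]; linarith
  have s2 : √x * √x = x := Real.mul_self_sqrt (by linarith)
  calc _ ≤ ∑ m ∈ Finset.range (Mx x + 1), |h m * Fs g (x / m) * (Real.log x / x) - c * (h m / m * (1 + vv x m))| :=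
        Finset.abs_sum_le_sum_abs _ _
    _ ≤ ∑ m ∈ Finset.range (Mx x + 1), C * (Real.log x / 2) ^ (-(1 + δ)) * Real.log x * (f m / m) := by
        refine Finset.sum_le_sum fun m hm => ?_
        have hm' : m ≤ Mx x := by simp at hm; omega
        rcases Nat.eq_zero_or_pos m with rfl | hm0
        · simp [h0]
        · have hm0' : (0:ℝ) < m := by exact_mod_cast hm0
          have hmx := Mx_le hm'
          have hy : √x ≤ x / m := by
            rw [le_div_iff₀ hm0']; nlinarith
          have hlg := lg_Mx (by linarith) hm'
          have hly : Real.log (x / m) = Real.log x - lg m := Real.log_div hx0.ne' hm0'.ne'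
          have hb := hg (x / m) (by linarith)
          have hl := ll_le_half hδ (show 0 < Real.log x / 2 by linarith) (show 1 ≤ x / m by linarith)
            (by rw [hly]; linarith)
          have hne : Real.log x - lg m ≠ 0 := by linarith
          have e : h m * Fs g (x / m) * (Real.log x / x) - c * (h m / m * (1 + vv x m)) =
              h m * (Fs g (x / m) - c * (x / m / Real.log (x / m))) * (Real.log x / x) := by
            rw [hly]; unfold vv
            field_simp
            ring
          rw [e, abs_mul, abs_mul, abs_of_pos (show 0 < Real.log x / x by positivity)]
          calc _ ≤ f m * (C * (x / m) * (Real.log x / 2) ^ (-(1 + δ))) * (Real.log x / x) := by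
                have := (abs_nonneg _).trans (hf m)
                gcongr
                · exact hf m
                · exact hb.trans (by gcongr)
            _ = _ := by field_simp
    _ = C * (Real.log x / 2) ^ (-(1 + δ)) * Real.log x * ∑ m ∈ Finset.range (Mx x + 1), f m / m := by
        rw [Finset.mul_sum]
    _ ≤ _ := by
        have := (abs_le.mp (hT x hx)).2
        gcongr
        linarith

lemma Fs_sqrt {δ c : ℝ} (hδ : 0 < δ) {g : ℕ → ℝ} (hg : GB δ c g) :
    ∃ C : ℝ, 0 ≤ C ∧ ∀ x : ℝ, 16 ≤ x → |Fs g √x| ≤ C * (√x / Real.log x) := by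
  obtain ⟨C, hC, hg⟩ := hg
  refine ⟨2 * |c| + 2 * C, by positivity, fun x hx => ?_⟩
  have s1 : 4 ≤ √x := by
    rw [Real.le_sqrt (by norm_num) (by linarith)]; linarith
  have hlx : 0 < Real.log x := Real.log_pos (by linarith)
  have hb := hg √x (by linarith)
  have hl : Real.log √x = Real.log x / 2 := Real.log_sqrt (by linarith)
  have l1 := ll_one (show 0 ≤ √x by linarith)
  have h1 : Real.log √x ≤ ll √x := by
    unfold ll
    have := Real.log_le_log (by linarith : 0 < √x) (by linarith : √x ≤ 1 + √x)
    linarith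
  have h2 : ll √x ^ (-(1 + δ)) ≤ 2 / Real.log x := by
    calc _ ≤ ll √x ^ (-1 : ℝ) := by gcongr <;> linarith
      _ = 1 / ll √x := by rw [Real.rpow_neg_one, one_div]
      _ ≤ 1 / (Real.log x / 2) := by gcongr; linarith
      _ = _ := by field_simp
  have h3 : |c * (√x / Real.log √x)| = 2 * |c| * (√x / Real.log x) := by
    rw [hl, abs_mul, abs_of_pos (show 0 < √x / (Real.log x / 2) by positivity)]
    field_simp
  have h4 : C * √x * ll √x ^ (-(1 + δ)) ≤ C * √x * (2 / Real.log x) := by gcongr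
  have h5 : Fs g √x = (Fs g √x - c * (√x / Real.log √x)) + c * (√x / Real.log √x) := by ring
  rw [h5]
  refine (abs_add_le _ _).trans ?_
  rw [h3]
  have h6 : C * √x * (2 / Real.log x) = 2 * C * (√x / Real.log x) := by ring
  linarith

lemma prod_lim {δ c c' : ℝ} (hδ : 0 < δ) {f g : ℕ → ℝ} (hf : GB δ c f) (hg : GB δ c' g) :
    Tendsto (fun x : ℝ => Fs f √x * Fs g √x * (Real.log x / x)) atTop (𝓝 0) := by
  obtain ⟨C, hC, hf⟩ := Fs_sqrt hδ hf
  obtain ⟨D, hD, hg⟩ := Fs_sqrt hδ hg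
  have lim : Tendsto (fun x : ℝ => C * D / Real.log x) atTop (𝓝 0) := Real.tendsto_log_atTop.const_div_atTop _
  refine squeeze_zero_norm' ?_ lim
  filter_upwards [eventually_ge_atTop 16] with x hx
  have hlx : 0 < Real.log x := Real.log_pos (by linarith)
  have hx0 : 0 < x := by linarith
  have s2 : √x * √x = x := Real.mul_self_sqrt (by linarith)
  rw [Real.norm_eq_abs, abs_mul, abs_mul, abs_of_pos (show 0 < Real.log x / x by positivity)]
  calc _ ≤ (C * (√x / Real.log x)) * (D * (√x / Real.log x)) * (Real.log x / x) := by
        have := hf x hx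
        have := hg x hx
        gcongr
    _ = C * D * (√x * √x) / (Real.log x * x) := by field_simp
    _ = _ := by rw [s2]; field_simp

lemma sum_vlog {x : ℝ} (hx : 16 ≤ x) :
    |∑ n ∈ Finset.range (Mx x + 1), 1 / lg n / n * vv x n| ≤ 3 := by
  have hlx : 1 ≤ Real.log x := by
    rw [Real.le_log_iff_exp_le (by linarith)]
    have := Real.exp_one_lt_d9
    linarith
  obtain ⟨h2, _, _⟩ := loglog_Mx hx
  have hM := lg_Mx (show 1 ≤ x by linarith) (le_refl (Mx x))
  have harm : ∑ n ∈ Finset.range (Mx x + 1), 1 / (n : ℝ) ≤ 1 + lg (Mx x) := by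
    have := harmonic_le_one_add_log (Mx x)
    rw [harmonic] at this
    push_cast at this
    rw [Finset.sum_range_succ']
    simpa [lg] using this
  calc _ ≤ ∑ n ∈ Finset.range (Mx x + 1), |1 / lg n / n * vv x n| := Finset.abs_sum_le_sum_abs _ _
    _ ≤ ∑ n ∈ Finset.range (Mx x + 1), 2 / Real.log x * (1 / n) := by
        refine Finset.sum_le_sum fun m hm => ?_
        have hm' : m ≤ Mx x := by simp at hm; omega
        have hlg := lg_Mx (by linarith) hm'
        have h0 := lg_nonneg m
        have hv := vv_nonneg (by linarith) hm'
        rw [abs_of_nonneg (by positivity)]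
        rcases h0.eq_or_lt with h | h
        · rw [← h]; simp; positivity
        · have hne : Real.log x - lg m ≠ 0 := by linarith
          have e : 1 / lg m / m * vv x m = 1 / (Real.log x - lg m) * (1 / m) := by
            unfold vv; field_simp
          rw [e]
          refine mul_le_mul_of_nonneg_right ?_ (by positivity)
          rw [div_le_div_iff₀ (by linarith) (by linarith)]
          linarith
    _ = 2 / Real.log x * ∑ n ∈ Finset.range (Mx x + 1), 1 / (n : ℝ) := by rw [Finset.mul_sum]
    _ ≤ 2 / Real.log x * (1 + Real.log x / 2) := by gcongr; linarith
    _ ≤ 3 := by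
        rw [div_mul_eq_mul_div, div_le_iff₀ (by linarith)]; linarith

end DGK

namespace DGK
open Complex MeasureTheory Set Topology

lemma PP_lim {f g : ℕ → ℝ} (hf : f 0 = 0) (hg : g 0 = 0) {s : ℝ → ℝ} {a b c : ℝ}
    (ha : Tendsto (fun x : ℝ => (∑ m ∈ Finset.range (Mx x + 1), f m * Fs g (x / m)) * (Real.log x / x) * s x) atTop (𝓝 a))
    (hb : Tendsto (fun x : ℝ => (∑ m ∈ Finset.range (Mx x + 1), g m * Fs f (x / m)) * (Real.log x / x) * s x) atTop (𝓝 b))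
    (hc : Tendsto (fun x : ℝ => Fs f √x * Fs g √x * (Real.log x / x) * s x) atTop (𝓝 c)) :
    Tendsto (fun x : ℝ => PP f g ⌊x⌋₊ * (Real.log x / x) * s x) atTop (𝓝 (a + b - c)) := by
  refine ((ha.add hb).sub hc).congr' ?_
  filter_upwards [eventually_ge_atTop 0] with x hx
  rw [hypR hf hg hx]
  unfold Mx
  ring

variable {d : ℕ} {χ : DirichletCharacter ℂ d}

lemma final [NeZero d] (hq : MulChar.IsQuadratic χ) (hne : χ ≠ 1) :
    ∃ L : ℝ, Tendsto (fun N : ℕ => ∑ n ∈ Finset.range N, f1 χ n / n) atTop (𝓝 L) ∧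
      Tendsto (fun x : ℝ => PP (f0 χ) (f1 χ) ⌊x⌋₊ * (Real.log x / x)) atTop (𝓝 L) ∧
      Tendsto (fun x : ℝ => PP (f1 χ) (f1 χ) ⌊x⌋₊ * (Real.log x / x)) atTop (𝓝 0) ∧
      Tendsto (fun x : ℝ => PP (f0 χ) (f0 χ) ⌊x⌋₊ * (Real.log x / x) * (Real.log (Real.log x))⁻¹) atTop (𝓝 2) := by
  obtain ⟨δ, hδ, hδ1, h1, h0⟩ := PB_main hq hne
  have z00 : f0 χ 0 = 0 := by simp [f0, pr_not Nat.not_prime_zero]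
  have z10 : f1 χ 0 = 0 := by simp [f1, pr_not Nat.not_prime_zero]
  have z01 : f0 χ 1 = 0 := by simp [f0, pr_not Nat.not_prime_one]
  have z11 : f1 χ 1 = 0 := by simp [f1, pr_not Nat.not_prime_one]
  obtain ⟨L, hL⟩ := PB_conv hδ h1 z10 z11
  obtain ⟨L0, hL0⟩ := PB_conv hδ h0 (by simp [z00, lg]) (by simp [z01, lg])
  have G1 : GB δ 0 (f1 χ) := by
    obtain ⟨C, hC, h⟩ := PB_real hδ h1
    exact ⟨C, hC, fun y hy => by simpa using h y (by linarith)⟩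
  have G0 : GB δ 1 (f0 χ) := by
    obtain ⟨C, hC, h⟩ := F0_bound hδ hδ1 h0
    exact ⟨C, hC, fun y hy => by simpa using h y hy⟩
  obtain ⟨K, hK⟩ := T_bound hL0
  have b0 : ∀ n, |f0 χ n| ≤ f0 χ n := fun n => by
    rw [abs_of_nonneg]; exact mul_nonneg (sq_nonneg _) (pr_nonneg n)
  have b1 : ∀ n, |f1 χ n| ≤ f0 χ n := fun n => by
    unfold f0 f1
    rw [abs_mul, abs_of_nonneg (pr_nonneg n)]
    refine mul_le_mul_of_nonneg_right ?_ (pr_nonneg n)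
    rcases cr_cases hq n with c | c | c <;> rw [c] <;> norm_num
  have E01 := err hδ G1 b0 z00 hK
  have E11 := err hδ G1 b1 z10 hK
  have E10 := err hδ G0 b1 z10 hK
  have E00 := err hδ G0 b0 z00 hK
  simp only [zero_mul, sub_zero, one_mul] at E01 E11 E10 E00
  have s1 : Tendsto (fun x : ℝ => ∑ m ∈ Finset.range (Mx x + 1), f1 χ m / m * (1 + vv x m)) atTop (𝓝 L) := by
    have a := toep_v hL
    have b : Tendsto (fun x : ℝ => ∑ m ∈ Finset.range (Mx x + 1), f1 χ m / m) atTop (𝓝 L) :=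
      hL.comp ((tendsto_add_atTop_nat 1).comp Mx_tendsto)
    have c := b.add a
    rw [add_zero] at c
    refine c.congr fun x => ?_
    rw [← Finset.sum_add_distrib]
    exact Finset.sum_congr rfl fun n _ => by ring
  have hll : Tendsto (fun x : ℝ => Real.log (Real.log x)) atTop atTop := Real.tendsto_log_atTop.comp Real.tendsto_log_atTop
  have hinv : Tendsto (fun x : ℝ => (Real.log (Real.log x))⁻¹) atTop (𝓝 0) := tendsto_inv_atTop_zero.comp hll
  have s0 : Tendsto (fun x : ℝ => (∑ m ∈ Finset.range (Mx x + 1), f0 χ m / m * (1 + vv x m)) * (Real.log (Real.log x))⁻¹) atTop (𝓝 1) := by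
    have a := (toep_v hL0).mul hinv
    rw [zero_mul] at a
    have b : Tendsto (fun x : ℝ => (∑ m ∈ Finset.range (Mx x + 1), 1 / lg m / m * vv x m
        + (∑ m ∈ Finset.range (Mx x + 1), f0 χ m / m - Real.log (Real.log x))) * (Real.log (Real.log x))⁻¹) atTop (𝓝 0) := by
      have lim := hinv.const_mul (3 + K)
      rw [mul_zero] at lim
      refine squeeze_zero_norm' ?_ lim
      filter_upwards [hll.eventually_gt_atTop 0, eventually_ge_atTop 16] with x hx hx16
      rw [Real.norm_eq_abs, abs_mul, abs_of_pos (inv_pos.mpr hx)]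
      refine mul_le_mul_of_nonneg_right ?_ (inv_pos.mpr hx).le
      exact (abs_add_le _ _).trans (add_le_add (sum_vlog hx16) (hK x hx16))
    have c := (a.add b).add_const 1
    rw [add_zero, zero_add] at c
    refine c.congr' ?_
    filter_upwards [hll.eventually_gt_atTop 0] with x hx
    have e : ∑ m ∈ Finset.range (Mx x + 1), f0 χ m / m * (1 + vv x m) =
      ∑ m ∈ Finset.range (Mx x + 1), (f0 χ m - 1 / lg m) / m * vv x m +
      ∑ m ∈ Finset.range (Mx x + 1), 1 / lg m / m * vv x m + ∑ m ∈ Finset.range (Mx x + 1), f0 χ m / m := by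
      rw [← Finset.sum_add_distrib, ← Finset.sum_add_distrib]
      exact Finset.sum_congr rfl fun n _ => by ring
    rw [e]
    field_simp
    ring
  refine ⟨L, hL, ?_, ?_, ?_⟩
  · have a : Tendsto (fun x : ℝ => (∑ m ∈ Finset.range (Mx x + 1), f1 χ m * Fs (f0 χ) (x / m)) * (Real.log x / x)) atTop (𝓝 L) := by
      have := E10.add s1
      simpa using this
    have := PP_lim (s := fun _ => 1) z00 z10 (by simpa using E01) (by simpa using a) (by simpa using prod_lim hδ G0 G1)
    simpa using this
  · have := PP_lim (s := fun _ => 1) z10 z10 (by simpa using E11) (by simpa using E11) (by simpa using prod_lim hδ G1 G1)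
    simpa using this
  · have a : Tendsto (fun x : ℝ => (∑ m ∈ Finset.range (Mx x + 1), f0 χ m * Fs (f0 χ) (x / m)) * (Real.log x / x)
        * (Real.log (Real.log x))⁻¹) atTop (𝓝 1) := by
      have := (E00.mul hinv).add s0
      simp only [mul_zero, zero_add] at this
      refine this.congr fun x => by ring
    have p := (prod_lim hδ G0 G0).mul hinv
    have := PP_lim z00 z00 a a p
    norm_num at this
    exact this

end DGK

/-- Dummit–Granville–Kisilevsky: for a quadratic (real primitive)
Dirichlet character `χ` of conductor `d` and `η = ±1`, as `x → ∞`,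
`#{pq ≤ x : χ(p) = χ(q) = η} / ((1/4) #{pq ≤ x : gcd(pq,d) = 1})
  = 1 + η (𝓛_χ + o(1)) / log log x`. -/
theorem statement_0 (d : ℕ) (hd : d ≠ 0) (χ : DirichletCharacter ℂ d)
    (hprim : χ.IsPrimitive) (hquad : MulChar.IsQuadratic χ) (hne : χ ≠ 1)
    (η : ℤ) (hη : η = 1 ∨ η = -1) :
    ∃ L : ℝ, HasCurlyL χ L ∧
      Filter.Tendsto
        (fun x : ℝ => (η : ℝ) * (raceRatio χ (η : ℂ) x - 1) * Real.log (Real.log x))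
        Filter.atTop (nhds L) := by
  have : NeZero d := ⟨hd⟩
  obtain ⟨L, hL, hS1, hS2, hN⟩ := DGK.final hquad hne
  refine ⟨L, ?_, ?_⟩
  · unfold HasCurlyL
    refine hL.congr fun y => ?_
    rw [Finset.sum_filter]
    refine Finset.sum_congr rfl fun n _ => ?_
    by_cases hp : n.Prime
    · simp [DGK.f1, DGK.cr, DGK.pr_of hp, hp]
    · simp [DGK.f1, DGK.pr_not hp, hp]
  · have hη2 : (η : ℝ) ^ 2 = 1 := by
      rcases hη with rfl | rfl <;> norm_num
    have hlim := ((hS1.const_mul 2).add (hS2.const_mul (η : ℝ))).div hN (by norm_num)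
    have e : (2 * L + (η : ℝ) * 0) / 2 = L := by ring
    rw [e] at hlim
    refine hlim.congr' ?_
    have hll : Tendsto (fun x : ℝ => Real.log (Real.log x)) atTop atTop :=
      Real.tendsto_log_atTop.comp Real.tendsto_log_atTop
    filter_upwards [eventually_gt_atTop 1, hll.eventually_gt_atTop 0,
      hN.eventually_ne (show (2:ℝ) ≠ 0 by norm_num)] with x hx hx2 hx3
    have hlx : 0 < Real.log x := Real.log_pos hx
    have hx0 : 0 < x := by linarith
    have c1 := DGK.count_eta hquad hη hx0.le
    have c2 := DGK.count_gcd hquad hx0.le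
    have c3 := DGK.PP_expand (DGK.f0 χ) (DGK.f1 χ) η hη2 ⌊x⌋₊
    have r : raceRatio χ (η : ℂ) x = 4 * DGK.PP (fun n => (DGK.f0 χ n + η * DGK.f1 χ n) / 2)
        (fun n => (DGK.f0 χ n + η * DGK.f1 χ n) / 2) ⌊x⌋₊ / DGK.PP (DGK.f0 χ) (DGK.f0 χ) ⌊x⌋₊ := by
      unfold raceRatio pairCount
      rw [c1, c2]
      ring
    rw [r, c3]
    simp only [Pi.div_apply]
    have hP : DGK.PP (DGK.f0 χ) (DGK.f0 χ) ⌊x⌋₊ ≠ 0 := fun h => hx3 (by rw [h]; ring)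
    generalize DGK.PP (DGK.f0 χ) (DGK.f0 χ) ⌊x⌋₊ = N0 at *
    generalize DGK.PP (DGK.f0 χ) (DGK.f1 χ) ⌊x⌋₊ = S1 at *
    generalize DGK.PP (DGK.f1 χ) (DGK.f1 χ) ⌊x⌋₊ = S2 at *
    field_simp
    linear_combination (-2 * S1) * hη2
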